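/- arXiv:2602.09177 — 5 statements merged into one kernel-verified Lean document; each statement's English description precedes it below -/
import Mathlib

section
/- Let n ≥ 3 and let F ∈ ℂ[X₀,X₁,X₂,X₃] be a homogeneous polynomial of degree n whose four partial derivatives ∂F/∂X₀, ∂F/∂X₁, ∂F/∂X₂, ∂F/∂X₃ are linearly independent over ℂ (equivalently, the surface V(F) ⊂ ℙ³ is not a cone). Let p₁,…,p_δ ∈ ℂ⁴ ∖ {0} be representatives of δ points of ℙ³, each a singular point of V(F), and suppose these δ points impose independent conditions on forms of degree n−1. Then δ ≤ C(n+2,3) − 4, where C(n+2,3) is the binomial coefficient 'n+2 choose 3'. -/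
open MvPolynomial

/-- The space of forms of degree `d` in finitely many variables has the stars-and-bars dimension. -/
theorem finrank_homogeneousSubmodule (σ K : Type*) [Fintype σ] [Field K] (d : ℕ) :
    Module.finrank K (homogeneousSubmodule σ K d) = (Fintype.card σ + d - 1).choose d := by
  classical
  have hset : {m : σ →₀ ℕ | m.degree = d} =
      (Finset.finsuppAntidiag (Finset.univ : Finset σ) d : Set (σ →₀ ℕ)) := by
    ext m
    simp [Finset.mem_finsuppAntidiag, Finsupp.degree_eq_sum]
  have hsub : homogeneousSubmodule σ K d =
      restrictSupport K (Finset.finsuppAntidiag (Finset.univ : Finset σ) d : Set (σ →₀ ℕ)) := by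
    rw [homogeneousSubmodule_eq_finsupp_supported, hset]
    rfl
  rw [hsub, Module.finrank_eq_nat_card_basis (basisRestrictSupport K _), Nat.card_coe_set_eq,
    Set.ncard_coe_finset, Finset.card_finsuppAntidiag_nat_eq_choose, Finset.card_univ]

/-- A degree-`n` surface in `ℙ³` that is not a cone (its four first
polars are linearly independent) has at most `C(n+2,3) - 4` singular points imposing
independent conditions on forms of degree `n - 1`. -/
theorem severi_bound (n δ : ℕ) (hn : 3 ≤ n)
    (F : MvPolynomial (Fin 4) ℂ) (hF : F.IsHomogeneous n)
    (hpolars : LinearIndependent ℂ (fun j : Fin 4 => pderiv j F))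
    (p : Fin δ → (Fin 4 → ℂ)) (hp0 : ∀ i, p i ≠ 0)
    (hpdist : ∀ i j, i ≠ j → ¬ ∃ c : ℂ, p i = c • p j)
    (hsing : ∀ (i : Fin δ) (j : Fin 4), eval (p i) (pderiv j F) = 0)
    (hindep : Function.Surjective
      (fun (G : homogeneousSubmodule (Fin 4) ℂ (n - 1)) (i : Fin δ) =>
        eval (p i) (G : MvPolynomial (Fin 4) ℂ))) :
    δ ≤ (n + 2).choose 3 - 4 := by
  have : Module.Finite ℂ (homogeneousSubmodule (Fin 4) ℂ (n - 1)) :=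
    Module.Finite.iff_fg.mpr (homogeneousSubmodule_fg _ _ _)
  obtain ⟨φ, hφ⟩ : ∃ φ : homogeneousSubmodule (Fin 4) ℂ (n - 1) →ₗ[ℂ] Fin δ → ℂ,
      ∀ G i, φ G i = eval (p i) (G : MvPolynomial (Fin 4) ℂ) :=
    ⟨(LinearMap.pi fun i => (aeval (p i)).toLinearMap) ∘ₗ Submodule.subtype _,
      fun G i => by simp [aeval_eq_eval]⟩
  have hrange : LinearMap.range φ = ⊤ := by
    refine LinearMap.range_eq_top.mpr fun y => ?_
    obtain ⟨G, hG⟩ := hindep y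
    refine ⟨G, ?_⟩
    ext i
    rw [hφ, ← hG]
  have hform : LinearIndependent ℂ (fun j : Fin 4 =>
      (⟨pderiv j F, hF.pderiv⟩ : homogeneousSubmodule (Fin 4) ℂ (n - 1))) :=
    LinearIndependent.of_comp (Submodule.subtype _) hpolars
  have hmem (j : Fin 4) :
      (⟨pderiv j F, hF.pderiv⟩ : homogeneousSubmodule (Fin 4) ℂ (n - 1)) ∈ LinearMap.ker φ := by
    rw [LinearMap.mem_ker]
    ext i
    rw [hφ]
    exact hsing i j
  have hpolar : LinearIndependent ℂ (fun j => (⟨_, hmem j⟩ : LinearMap.ker φ)) :=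
    LinearIndependent.of_comp (LinearMap.ker φ).subtype hform
  have hker : 4 ≤ Module.finrank ℂ (LinearMap.ker φ) := by
    simpa using hpolar.fintype_card_le_finrank
  have hrank := φ.finrank_range_add_finrank_ker
  have hdim : Module.finrank ℂ (homogeneousSubmodule (Fin 4) ℂ (n - 1)) = (n + 2).choose 3 := by
    rw [finrank_homogeneousSubmodule, Fintype.card_fin, show 4 + (n - 1) - 1 = n + 2 by omega]
    exact Nat.choose_symm_of_eq_add (by omega)
  rw [hrange, finrank_top, Module.finrank_fin_fun, hdim] at hrank
  omega
end

section
/- Let f ∈ ℂ[x,y,z] be a homogeneous polynomial of degree 3 such that the only common zero in ℂ³ of the three partial derivatives ∂f/∂x, ∂f/∂y, ∂f/∂z is the origin (i.e., f defines a smooth plane cubic curve). Let 𝔪 = (x,y,z) be the irrelevant maximal ideal of ℂ[x,y,z] and let J = (∂f/∂x, ∂f/∂y, ∂f/∂z) be the Jacobian ideal. Then 𝔪⁴ = 𝔪²·J; in particular every homogeneous polynomial of degree 4 in ℂ[x,y,z] can be written as a·(∂f/∂x) + b·(∂f/∂y) + c·(∂f/∂z) with a, b, c homogeneous of degree 2.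 -/
open MvPolynomial

/-- If a homogeneous polynomial is a combination of homogeneous polynomials, the coefficients may be
replaced by their homogeneous components of the complementary degree. -/
theorem MvPolynomial.IsHomogeneous.eq_sum_homogeneousComponent_mul {ι σ R : Type*} [Fintype ι]
    [CommSemiring R] {N : ℕ} {n d : ι → ℕ} {p c : ι → MvPolynomial σ R} {h : MvPolynomial σ R}
    (hh : h.IsHomogeneous N) (hp : ∀ i, (p i).IsHomogeneous (d i)) (hn : ∀ i, n i + d i = N)
    (hc : h = ∑ i, c i * p i) : h = ∑ i, homogeneousComponent (n i) (c i) * p i := by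
  have key (i : ι) :
      homogeneousComponent N (c i * p i) = homogeneousComponent (n i) (c i) * p i := by
    let _ := gradedAlgebra (σ := σ) (R := R)
    rw [← hn i]
    simp_rw [← decomposition.decompose'_apply]
    exact DirectSum.coe_decompose_mul_add_of_right_mem (homogeneousSubmodule σ R)
      ((mem_homogeneousSubmodule _ _).2 (hp i))
  rw [← homogeneousComponent_eq_self hh, hc, map_sum]
  exact Finset.sum_congr rfl fun i _ => key i

theorem MvPolynomial.IsHomogeneous.mem_idealOfVars_pow {σ R : Type*} [CommSemiring R] {n : ℕ}
    {p : MvPolynomial σ R} (hp : p.IsHomogeneous n) : p ∈ idealOfVars σ R ^ n := by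
  rw [mem_pow_idealOfVars_iff']
  intro x hx
  exact hp.coeff_eq_zero hx.ne

theorem MvPolynomial.IsHomogeneous.exists_eq_sum_mul_X {σ R : Type*} [Fintype σ] [CommSemiring R]
    {n : ℕ} {p : MvPolynomial σ R} (hp : p.IsHomogeneous (n + 1)) :
    ∃ c : σ → MvPolynomial σ R, (∀ i, (c i).IsHomogeneous n) ∧ p = ∑ i, c i * X i := by
  have hmem : p ∈ idealOfVars σ R :=
    Ideal.pow_le_self n.succ_ne_zero hp.mem_idealOfVars_pow
  obtain ⟨c, hc⟩ := Ideal.mem_span_range_iff_exists_fun.1 hmem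
  exact ⟨_, fun i => homogeneousComponent_isHomogeneous _ _,
    hp.eq_sum_homogeneousComponent_mul (fun i => isHomogeneous_X R i) (fun _ => rfl) hc.symm⟩

/-- A ternary quadratic form is a binary one up to a multiple of the last variable. -/
theorem exists_eq_binary_add_X_mul {R : Type*} [CommSemiring R] {p : MvPolynomial (Fin 3) R}
    (hp : p.IsHomogeneous 2) :
    ∃ (a b c : R) (l : MvPolynomial (Fin 3) R),
      p = C a * X 0 ^ 2 + C b * (X 0 * X 1) + C c * X 1 ^ 2 + X 2 * l := by
  obtain ⟨u, hu, rfl⟩ := hp.exists_eq_sum_mul_X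
  choose v hv huv using fun i => (hu i).exists_eq_sum_mul_X
  have hC (i j : Fin 3) : ∃ r : R, v i j = C r :=
    ⟨_, totalDegree_eq_zero_iff_eq_C.1 (Nat.le_zero.1 (hv i j).totalDegree_le)⟩
  choose r hr using hC
  refine ⟨r 0 0, r 0 1 + r 1 0, r 1 1,
    C (r 0 2) * X 0 + C (r 1 2) * X 1 + u 2, ?_⟩
  rw [Fin.sum_univ_three, huv 0, huv 1]
  simp only [Fin.sum_univ_three, hr, C_add]
  ring

/-- Modulo the last variable, a split binary quadratic form `(x - r₁ y) (x - r₂ y)` and a second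
binary quadratic form without common root, all cubic monomials vanish. -/
theorem mul_mul_eq_zero_of_quadrics {A : Type*} [CommRing A] {v : Fin 3 → A}
    {r₁ r₂ a b c f₁ f₂ : A} (hv : v 2 = 0)
    (hsplit : (v 0 - r₁ * v 1) * (v 0 - r₂ * v 1) = 0)
    (hq : a * v 0 ^ 2 + b * (v 0 * v 1) + c * v 1 ^ 2 = 0)
    (h₁ : (a * r₁ ^ 2 + b * r₁ + c) * f₁ = 1) (h₂ : (a * r₂ ^ 2 + b * r₂ + c) * f₂ = 1)
    (i j k : Fin 3) : v i * v j * v k = 0 := by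
  have hyy : (v 0 - r₁ * v 1) * v 1 ^ 2 = 0 := by
    linear_combination -(v 0 - r₁ * v 1) * v 1 ^ 2 * h₂ + f₂ * (v 0 - r₁ * v 1) * hq
      - f₂ * (a * (v 0 + r₂ * v 1) + b * v 1) * hsplit
  have hxy : (v 0 - r₁ * v 1) * (v 0 * v 1) = 0 := by
    linear_combination v 1 * hsplit + r₂ * hyy
  have h03 : v 1 ^ 3 = 0 := by
    linear_combination -v 1 ^ 3 * h₁ + f₁ * v 1 * hq - f₁ * a * hxy - f₁ * (a * r₁ + b) * hyy
  have h12 : v 0 * v 1 ^ 2 = 0 := by linear_combination hyy + r₁ * h03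
  have h21 : v 0 ^ 2 * v 1 = 0 := by linear_combination hxy + r₁ * h12
  have h30 : v 0 ^ 3 = 0 := by
    linear_combination v 0 * hsplit + (r₁ + r₂) * h21 - r₁ * r₂ * h12
  fin_cases i <;> fin_cases j <;> fin_cases k <;>
    simp only [Fin.zero_eta, Fin.mk_one, Fin.reduceFinMk, hv, mul_zero, zero_mul] <;>
    first
      | linear_combination h30
      | linear_combination h21
      | linear_combination h12
      | linear_combination h03

/-- Restriction of ternary polynomials to the plane where the last coordinate vanishes. -/
noncomputable def restrictPlane (R : Type*) [CommRing R] :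
    MvPolynomial (Fin 3) R →ₐ[R] MvPolynomial (Fin 3) R :=
  aeval ![X 0, X 1, 0]

theorem X_two_dvd_restrictPlane_sub {R : Type*} [CommRing R] (p : MvPolynomial (Fin 3) R) :
    X 2 ∣ restrictPlane R p - p := by
  rw [← Ideal.mem_span_singleton, ← Ideal.Quotient.mk_eq_mk_iff_sub_mem]
  have : (Ideal.Quotient.mkₐ R (Ideal.span {X 2})).comp (restrictPlane R) =
      Ideal.Quotient.mkₐ R (Ideal.span {X 2}) := by
    ext i
    fin_cases i
    · simp [restrictPlane]
    · simp [restrictPlane]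
    · simp [restrictPlane]
  exact DFunLike.congr_fun this p

/-- If powers of the first two variables lie in the ideal generated by the last variable, `p₁` and
`p₂`, then the last variable is a nonzerodivisor modulo `p₁, p₂`. -/
theorem mem_span_pair_of_X_two_mul_mem {R : Type*} [CommRing R] [IsDomain R]
    {p₁ p₂ c : MvPolynomial (Fin 3) R} {m n : ℕ} (hne : restrictPlane R p₁ ≠ 0)
    (hx : X 0 ^ m ∈ Ideal.span {X 2, p₁, p₂}) (hy : X 1 ^ n ∈ Ideal.span {X 2, p₁, p₂})
    (hc : X 2 * c ∈ Ideal.span {p₁, p₂}) : c ∈ Ideal.span {p₁, p₂} := by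
  set ρ := restrictPlane R with hρ
  have hρ0 : ρ (X 0) = X 0 := by simp [hρ, restrictPlane]
  have hρ1 : ρ (X 1) = X 1 := by simp [hρ, restrictPlane]
  have hρ2 : ρ (X 2) = 0 := by simp [hρ, restrictPlane]
  obtain ⟨a, b, hab⟩ := Ideal.mem_span_pair.1 hc
  have hab' : ρ a * ρ p₁ + ρ b * ρ p₂ = 0 := by
    simpa [hρ2] using congr_arg ρ hab
  have hdvd {t : MvPolynomial (Fin 3) R} (ht : t ∈ Ideal.span {X 2, p₁, p₂}) :
      ρ p₁ ∣ ρ b * ρ t := by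
    obtain ⟨w, u, v, rfl⟩ := Submodule.mem_span_triple.1 ht
    refine ⟨ρ b * ρ u - ρ v * ρ a, ?_⟩
    simp only [smul_eq_mul, map_add, map_mul, hρ2]
    linear_combination ρ v * hab'
  obtain ⟨h, hh⟩ : ρ p₁ ∣ ρ b := by
    obtain ⟨s, hs⟩ := hdvd hx
    obtain ⟨t, ht⟩ := hdvd hy
    simp only [map_pow, hρ0, hρ1] at hs ht
    have hmul : s * X 1 ^ n = t * X 0 ^ m := by
      apply mul_left_cancel₀ hne
      linear_combination X 0 ^ m * ht - X 1 ^ n * hs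
    have hX : (X 0 : MvPolynomial (Fin 3) R) ^ m ∣ s := by
      refine (X_prime (i := 0)).pow_dvd_of_dvd_mul_right m (b := X 1 ^ n) ?_ ⟨t, by rw [hmul]; ring⟩
      intro hd
      simpa using X_dvd_X.1 ((X_prime (R := R) (i := (0 : Fin 3))).dvd_of_dvd_pow hd)
    obtain ⟨s', rfl⟩ := hX
    refine ⟨s', mul_right_cancel₀ (pow_ne_zero m (X_ne_zero (R := R) (0 : Fin 3))) ?_⟩
    rw [hs]; ring
  have ha : ρ a = -(h * ρ p₂) := by
    apply mul_right_cancel₀ hne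
    rw [hh] at hab'
    linear_combination hab'
  obtain ⟨a', ha'⟩ := X_two_dvd_restrictPlane_sub a
  obtain ⟨b', hb'⟩ := X_two_dvd_restrictPlane_sub b
  obtain ⟨p', hp'⟩ := X_two_dvd_restrictPlane_sub p₁
  obtain ⟨q', hq'⟩ := X_two_dvd_restrictPlane_sub p₂
  refine Ideal.mem_span_pair.2 ⟨-h * q' - a', h * p' - b', ?_⟩
  apply mul_left_cancel₀ (X_ne_zero (R := R) (2 : Fin 3))
  linear_combination hab - p₁ * (ha - ha') - p₂ * (hh - hb') + h * p₁ * hq' - h * p₂ * hp'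

open scoped Pointwise in
/-- A net of ternary quadratic forms without common zero contains two forms which generate, together
with the last variable, all cubic forms. -/
theorem exists_pair_cubics_mem {q : Fin 3 → MvPolynomial (Fin 3) ℂ}
    (hq : ∀ i, (q i).IsHomogeneous 2) (hz : ∀ x : Fin 3 → ℂ, (∀ i, eval x (q i) = 0) → x = 0) :
    ∃ p₁ ∈ Ideal.span (Set.range q), ∃ p₂ ∈ Ideal.span (Set.range q),
      p₁.IsHomogeneous 2 ∧ p₂.IsHomogeneous 2 ∧ restrictPlane ℂ p₁ ≠ 0 ∧
      idealOfVars (Fin 3) ℂ ^ 3 ≤ Ideal.span {X 2, p₁, p₂} := by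
  have hne (x : Fin 3 → ℂ) (hx : x ≠ 0) : ∃ i, eval x (q i) ≠ 0 := by
    by_contra! h
    exact hx (hz x h)
  have hmem (i : Fin 3) : q i ∈ Ideal.span (Set.range q) := Ideal.subset_span ⟨i, rfl⟩
  obtain ⟨i, hi⟩ := hne ![1, 0, 0] fun h => by simpa using congr_fun h 0
  obtain ⟨a, b, c, l, hl⟩ := exists_eq_binary_add_X_mul (hq i)
  have ha : a ≠ 0 := by simpa [hl] using hi
  obtain ⟨s, hs⟩ := IsAlgClosed.exists_pow_nat_eq (b ^ 2 - 4 * a * c) two_pos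
  obtain ⟨r₁, r₂, hb, hc⟩ : ∃ r₁ r₂ : ℂ, b = -a * (r₁ + r₂) ∧ c = a * (r₁ * r₂) := by
    refine ⟨(-b + s) / (2 * a), (-b - s) / (2 * a), by field_simp; ring, ?_⟩
    field_simp
    linear_combination hs
  have hr (r : ℂ) : ![r, 1, 0] ≠ 0 := fun h => by simpa using congr_fun h 1
  obtain ⟨p, hpmem, hp, hp₁, hp₂⟩ : ∃ p ∈ Ideal.span (Set.range q), p.IsHomogeneous 2 ∧
      eval ![r₁, 1, 0] p ≠ 0 ∧ eval ![r₂, 1, 0] p ≠ 0 := by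
    obtain ⟨j, hj⟩ := hne _ (hr r₁)
    obtain ⟨k, hk⟩ := hne _ (hr r₂)
    by_cases hj' : eval ![r₂, 1, 0] (q j) = 0
    · by_cases hk' : eval ![r₁, 1, 0] (q k) = 0
      · exact ⟨q j + q k, add_mem (hmem j) (hmem k), (hq j).add (hq k),
          by rwa [map_add, hk', add_zero], by rwa [map_add, hj', zero_add]⟩
      · exact ⟨q k, hmem k, hq k, hk', hk⟩
    · exact ⟨q j, hmem j, hq j, hj, hj'⟩
  obtain ⟨a', b', c', l', hl'⟩ := exists_eq_binary_add_X_mul hp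
  refine ⟨q i, hmem i, p, hpmem, hq i, hp, ?_, ?_⟩
  · intro h
    have := congr_arg (eval ![1, 0, 0]) h
    rw [hl] at this
    exact ha (by simpa [restrictPlane] using this)
  set K : Ideal (MvPolynomial (Fin 3) ℂ) := Ideal.span {X 2, q i, p} with hK
  let π := Ideal.Quotient.mk K
  have hπ2 : π (X 2) = 0 := Ideal.Quotient.eq_zero_iff_mem.2 (Ideal.subset_span (by simp))
  have hπq : π (q i) = 0 := Ideal.Quotient.eq_zero_iff_mem.2 (Ideal.subset_span (by simp))
  have hπp : π p = 0 := Ideal.Quotient.eq_zero_iff_mem.2 (Ideal.subset_span (by simp))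
  have hinv {u : ℂ} (hu : u ≠ 0) : π (C u) * π (C u⁻¹) = 1 := by
    rw [← map_mul, ← C_mul, mul_inv_cancel₀ hu, C_1, map_one]
  have hsplit : (π (X 0) - π (C r₁) * π (X 1)) * (π (X 0) - π (C r₂) * π (X 1)) = 0 := by
    rw [hl, hb, hc] at hπq
    simp only [map_add, map_mul, map_pow, map_neg, hπ2] at hπq
    linear_combination π (C a⁻¹) * hπq -
      (π (X 0) - π (C r₁) * π (X 1)) * (π (X 0) - π (C r₂) * π (X 1)) * hinv ha
  have hquad : π (C a') * π (X 0) ^ 2 + π (C b') * (π (X 0) * π (X 1)) +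
      π (C c') * π (X 1) ^ 2 = 0 := by
    rw [hl'] at hπp
    simpa only [map_add, map_mul, map_pow, hπ2, zero_mul, add_zero] using hπp
  have hval {r : ℂ} (hr : eval ![r, 1, 0] p ≠ 0) :
      (π (C a') * π (C r) ^ 2 + π (C b') * π (C r) + π (C c')) *
        π (C (a' * r ^ 2 + b' * r + c')⁻¹) = 1 := by
    have hu : a' * r ^ 2 + b' * r + c' ≠ 0 := by simpa [hl'] using hr
    rw [← hinv hu]
    simp only [map_add, map_mul, map_pow]
  have hmon := mul_mul_eq_zero_of_quadrics (v := fun i => π (X i)) hπ2 hsplit hquad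
    (hval hp₁) (hval hp₂)
  rw [idealOfVars, Ideal.span, Submodule.span_pow, Submodule.span_le]
  rw [pow_succ, pow_two]
  rintro _ ⟨_, ⟨_, ⟨i, rfl⟩, _, ⟨j, rfl⟩, rfl⟩, _, ⟨k, rfl⟩, rfl⟩
  refine Ideal.Quotient.eq_zero_iff_mem.1 ?_
  simpa only [map_mul] using hmon i j k

/-- Reducing a form modulo `p₁, p₂` to a multiple of a power of the last variable. -/
theorem exists_X_two_pow_mul_sub_mem {R : Type*} [CommRing R]
    {p₁ p₂ : MvPolynomial (Fin 3) R} (h₁ : p₁.IsHomogeneous 2) (h₂ : p₂.IsHomogeneous 2)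
    (hcubics : idealOfVars (Fin 3) R ^ 3 ≤ Ideal.span {X 2, p₁, p₂}) (k : ℕ)
    {c : MvPolynomial (Fin 3) R} (hc : c.IsHomogeneous (k + 2)) :
    ∃ d, c - X 2 ^ k * d ∈ Ideal.span {p₁, p₂} := by
  induction k generalizing c with
  | zero => exact ⟨c, by simp⟩
  | succ k ih =>
    have hmem := hcubics (Ideal.pow_le_pow_right (by lia : 3 ≤ k + 1 + 2) hc.mem_idealOfVars_pow)
    obtain ⟨u, v₁, v₂, huv⟩ := Submodule.mem_span_triple.1 hmem
    have hsum : c = ∑ i, ![u, v₁, v₂] i * ![X 2, p₁, p₂] i := by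
      simp [Fin.sum_univ_three, ← huv]
    have hcomp := hc.eq_sum_homogeneousComponent_mul (d := ![1, 2, 2])
      (n := ![k + 2, k + 1, k + 1])
      (fun i => by fin_cases i; exacts [isHomogeneous_X R 2, h₁, h₂])
      (fun i => by fin_cases i <;> simp) hsum
    obtain ⟨d, hd⟩ := ih (homogeneousComponent_isHomogeneous (k + 2) u)
    refine ⟨d, ?_⟩
    obtain ⟨e₁, e₂, he⟩ := Ideal.mem_span_pair.1 hd
    refine Ideal.mem_span_pair.2 ⟨homogeneousComponent (k + 1) v₁ + X 2 * e₁,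
      homogeneousComponent (k + 1) v₂ + X 2 * e₂, ?_⟩
    simp [Fin.sum_univ_three] at hcomp
    linear_combination X 2 * he - hcomp

/-- Three ternary quadratic forms without common zero generate all quartic forms. -/
theorem quartic_mem_span_quadrics {q : Fin 3 → MvPolynomial (Fin 3) ℂ}
    (hq : ∀ i, (q i).IsHomogeneous 2) (hz : ∀ x : Fin 3 → ℂ, (∀ i, eval x (q i) = 0) → x = 0)
    {g : MvPolynomial (Fin 3) ℂ} (hg : g.IsHomogeneous 4) : g ∈ Ideal.span (Set.range q) := by
  obtain ⟨p₁, hp₁, p₂, hp₂, hh₁, hh₂, hne, hcubics⟩ := exists_pair_cubics_mem hq hz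
  have hle : Ideal.span {p₁, p₂} ≤ Ideal.span (Set.range q) := by
    rw [Ideal.span_le]
    rintro _ (rfl | rfl)
    exacts [hp₁, hp₂]
  obtain ⟨k, hk⟩ : X 2 ∈ (Ideal.span (Set.range q)).radical := by
    rw [← vanishingIdeal_zeroLocus_eq_radical (K := ℂ), mem_vanishingIdeal_iff]
    intro x hx
    rw [zeroLocus_span] at hx
    rw [hz x fun i => by simpa [aeval_eq_eval] using hx (q i) ⟨i, rfl⟩]
    simp
  obtain ⟨c, hc⟩ := Ideal.mem_span_range_iff_exists_fun.1 (Ideal.mul_mem_right g _ hk)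
  have hcomp := (((isHomogeneous_X ℂ (2 : Fin 3)).pow k).mul hg).eq_sum_homogeneousComponent_mul
    (n := fun _ => k + 2) hq (fun _ => by lia) hc.symm
  choose d hd using fun i => exists_X_two_pow_mul_sub_mem hh₁ hh₂ hcubics k
    (homogeneousComponent_isHomogeneous (k + 2) (c i))
  have hcancel (m : ℕ) {t : MvPolynomial (Fin 3) ℂ} (ht : X 2 ^ m * t ∈ Ideal.span {p₁, p₂}) :
      t ∈ Ideal.span {p₁, p₂} := by
    induction m with
    | zero => simpa using ht
    | succ m ih =>
      rw [pow_succ', mul_assoc] at ht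
      exact ih (mem_span_pair_of_X_two_mul_mem hne
        (hcubics (isHomogeneous_X_pow 0 3).mem_idealOfVars_pow)
        (hcubics (isHomogeneous_X_pow 1 3).mem_idealOfVars_pow) ht)
  have hsub : g - ∑ i, d i * q i ∈ Ideal.span {p₁, p₂} := by
    apply hcancel k
    have : X 2 ^ k * (g - ∑ i, d i * q i) =
        ∑ i, (homogeneousComponent (k + 2) (c i) - X 2 ^ k * d i) * q i := by
      simp only [mul_sub, sub_mul, Finset.sum_sub_distrib, hcomp, Finset.mul_sum, mul_assoc]
    rw [this]
    exact sum_mem fun i _ => Ideal.mul_mem_right _ _ (hd i)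
  rw [← sub_add_cancel g (∑ i, d i * q i)]
  exact add_mem (hle hsub)
    (sum_mem fun i _ => Ideal.mul_mem_left _ _ (Ideal.subset_span ⟨i, rfl⟩))

/-- Finite determinacy computation for the cone over a smooth plane cubic:
if `f` is a homogeneous cubic in three variables whose partial derivatives have the
origin as their only common zero, then `𝔪⁴ = 𝔪² · J` where `𝔪 = (x,y,z)` and `J` is the
Jacobian ideal; in particular every quartic form is a combination `a·f_x + b·f_y + c·f_z`
with `a, b, c` homogeneous quadrics. -/
theorem finite_determinacy_cubic (f : MvPolynomial (Fin 3) ℂ)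
    (hf : f.IsHomogeneous 3)
    (hsmooth : ∀ x : Fin 3 → ℂ, (∀ i, eval x (pderiv i f) = 0) → x = 0) :
    (Ideal.span (Set.range (X : Fin 3 → MvPolynomial (Fin 3) ℂ))) ^ 4 =
      (Ideal.span (Set.range (X : Fin 3 → MvPolynomial (Fin 3) ℂ))) ^ 2 *
        Ideal.span (Set.range fun i : Fin 3 => pderiv i f) ∧
    ∀ g : MvPolynomial (Fin 3) ℂ, g.IsHomogeneous 4 →
      ∃ a : Fin 3 → MvPolynomial (Fin 3) ℂ,
        (∀ i, (a i).IsHomogeneous 2) ∧ g = ∑ i, a i * pderiv i f := by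
  have hq (i : Fin 3) : (pderiv i f).IsHomogeneous 2 := hf.pderiv
  have hforms (g : MvPolynomial (Fin 3) ℂ) (hg : g.IsHomogeneous 4) :
      ∃ a : Fin 3 → MvPolynomial (Fin 3) ℂ,
        (∀ i, (a i).IsHomogeneous 2) ∧ g = ∑ i, a i * pderiv i f := by
    obtain ⟨c, hc⟩ := Ideal.mem_span_range_iff_exists_fun.1
      (quartic_mem_span_quadrics hq hsmooth hg)
    exact ⟨_, fun i => homogeneousComponent_isHomogeneous _ _,
      hg.eq_sum_homogeneousComponent_mul hq (fun _ => rfl) hc.symm⟩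
  refine ⟨le_antisymm ?_ ?_, hforms⟩
  · rw [pow_idealOfVars_eq_span, Ideal.span_le]
    rintro _ ⟨s, hs, rfl⟩
    obtain ⟨a, ha, hsum⟩ := hforms (monomial s 1) (isHomogeneous_monomial 1 hs)
    change monomial s 1 ∈ _
    rw [hsum]
    exact sum_mem fun i _ =>
      Ideal.mul_mem_mul (ha i).mem_idealOfVars_pow (Ideal.subset_span ⟨i, rfl⟩)
  · rw [show 4 = 2 + 2 from rfl, pow_add]
    refine Ideal.mul_mono_right (Ideal.span_le.2 ?_)
    rintro _ ⟨i, rfl⟩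
    exact (hq i).mem_idealOfVars_pow
end

section
/- Let F ∈ ℂ[X₀,X₁,X₂,X₃] be a homogeneous polynomial of degree 3 such that the surface X = V(F) ⊂ ℙ³ has exactly four singular points, each of which is a node. Then there exists a plane H ⊂ ℙ³ containing none of the four nodes such that H ∩ X is the union of three distinct lines that do not all pass through a common point; moreover, the seven points consisting of the four nodes of X and the three pairwise intersection points of these three lines impose independent conditions on forms of degree 3, i.e., the space of homogeneous degree-3 polynomials in ℂ[X₀,X₁,X₂,X₃] vanishing at all seven points has dimension 20 − 7 = 13. -/
open MvPolynomial

section Algebra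

theorem MvPolynomial.pderiv_comm {σ R : Type*} [CommRing R] (i j : σ) (F : MvPolynomial σ R) :
    pderiv i (pderiv j F) = pderiv j (pderiv i F) := by
  classical
  have h : ⁅(pderiv i : Derivation R (MvPolynomial σ R) (MvPolynomial σ R)), pderiv (R := R) j⁆ = 0 := by
    refine MvPolynomial.derivation_ext fun k => ?_
    simp [Derivation.commutator_apply, pderiv_X, Pi.single_apply, apply_ite]
  have := congrArg (fun D => D F) h
  simpa [Derivation.commutator_apply, sub_eq_zero] using this

/-- The linear form on `Fin 4 → ℂ`, as a polynomial. -/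
noncomputable def linForm (f : (Fin 4 → ℂ) →ₗ[ℂ] ℂ) : MvPolynomial (Fin 4) ℂ :=
  ∑ j, C (f (Pi.single j 1)) * X j

theorem eval_linForm (f : (Fin 4 → ℂ) →ₗ[ℂ] ℂ) (x : Fin 4 → ℂ) : eval x (linForm f) = f x := by
  rw [LinearMap.pi_apply_eq_sum_univ f x]
  simp only [linForm, map_sum, map_mul, eval_C, eval_X, smul_eq_mul]
  refine Finset.sum_congr rfl fun j _ => ?_
  rw [mul_comm]
  congr 2
  ext k
  simp [Pi.single_apply, eq_comm]

theorem linForm_isHomogeneous (f : (Fin 4 → ℂ) →ₗ[ℂ] ℂ) : (linForm f).IsHomogeneous 1 :=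
  IsHomogeneous.sum _ _ _ fun j _ => isHomogeneous_C_mul_X _ j

/-- The polarization of a cubic form: a symmetric trilinear form recording its derivatives. -/
theorem exists_polarization (F : MvPolynomial (Fin 4) ℂ) (hF : F.IsHomogeneous 3) :
    ∃ T : (Fin 4 → ℂ) →ₗ[ℂ] (Fin 4 → ℂ) →ₗ[ℂ] (Fin 4 → ℂ) →ₗ[ℂ] ℂ,
      (∀ x y z, T x y z = T y x z) ∧ (∀ x y z, T x y z = T x z y) ∧
      (∀ x y z, T x y z = ∑ i, ∑ j, y i * z j * eval x (pderiv i (pderiv j F))) ∧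
      (∀ x z, T x x z = 2 * ∑ j, z j * eval x (pderiv j F)) ∧
      (∀ x, T x x x = 6 * eval x F) := by
  have hconst : ∀ i j k, ∃ a : ℂ, pderiv i (pderiv j (pderiv k F)) = C a := fun i j k => by
    have h : (pderiv i (pderiv j (pderiv k F))).IsHomogeneous 0 := hF.pderiv.pderiv.pderiv
    exact ⟨_, totalDegree_eq_zero_iff_eq_C.1 ((totalDegree_zero_iff_isHomogeneous _).2 h)⟩
  choose c hc using hconst
  have c12 : ∀ i j k, c i j k = c j i k := fun i j k =>
    C_injective (Fin 4) ℂ (by rw [← hc, ← hc, pderiv_comm])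
  have c23 : ∀ i j k, c i j k = c i k j := fun i j k =>
    C_injective (Fin 4) ℂ (by rw [← hc, ← hc, pderiv_comm j k])
  have e2 : ∀ x i j, eval x (pderiv i (pderiv j F)) = ∑ k, x k * c k i j := fun x i j => by
    have h : (pderiv i (pderiv j F)).IsHomogeneous 1 := hF.pderiv.pderiv
    have := congrArg (eval x) h.sum_X_mul_pderiv
    simpa [hc] using this.symm
  have e1 : ∀ x j, 2 * eval x (pderiv j F) = ∑ i, x i * eval x (pderiv i (pderiv j F)) :=
    fun x j => by
    have h : (pderiv j F).IsHomogeneous 2 := hF.pderiv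
    have := congrArg (eval x) h.sum_X_mul_pderiv
    simpa using this.symm
  have e0 : ∀ x, 3 * eval x F = ∑ i, x i * eval x (pderiv i F) := fun x => by
    have := congrArg (eval x) hF.sum_X_mul_pderiv
    simpa using this.symm
  let T : (Fin 4 → ℂ) →ₗ[ℂ] (Fin 4 → ℂ) →ₗ[ℂ] (Fin 4 → ℂ) →ₗ[ℂ] ℂ :=
    ∑ i, ∑ j, ∑ k, c i j k • (LinearMap.proj i : (Fin 4 → ℂ) →ₗ[ℂ] ℂ).smulRight
      ((LinearMap.proj j : (Fin 4 → ℂ) →ₗ[ℂ] ℂ).smulRight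
        (LinearMap.proj k : (Fin 4 → ℂ) →ₗ[ℂ] ℂ))
  have hT : ∀ x y z, T x y z = ∑ i, ∑ j, ∑ k, c i j k * (x i * (y j * z k)) := fun x y z => by
    simp [T, LinearMap.sum_apply]
  have hT2 : ∀ x y z, T x y z = ∑ i, ∑ j, y i * z j * eval x (pderiv i (pderiv j F)) := by
    intro x y z
    rw [hT, Finset.sum_comm]
    refine Finset.sum_congr rfl fun i _ => ?_
    rw [Finset.sum_comm]
    refine Finset.sum_congr rfl fun j _ => ?_
    rw [e2, Finset.mul_sum]
    exact Finset.sum_congr rfl fun k _ => by ring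
  have hT1 : ∀ x z, T x x z = 2 * ∑ j, z j * eval x (pderiv j F) := by
    intro x z
    rw [hT2, Finset.sum_comm, Finset.mul_sum]
    refine Finset.sum_congr rfl fun j _ => ?_
    rw [mul_left_comm, e1, Finset.mul_sum]
    exact Finset.sum_congr rfl fun k _ => by ring
  refine ⟨T, fun x y z => ?_, fun x y z => ?_, hT2, hT1, fun x => ?_⟩
  · rw [hT, hT, Finset.sum_comm]
    refine Finset.sum_congr rfl fun i _ => Finset.sum_congr rfl fun j _ =>
      Finset.sum_congr rfl fun k _ => ?_
    rw [c12]; ring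
  · rw [hT, hT]
    refine Finset.sum_congr rfl fun i _ => ?_
    rw [Finset.sum_comm]
    refine Finset.sum_congr rfl fun j _ => Finset.sum_congr rfl fun k _ => ?_
    rw [c23]; ring
  · rw [hT1, ← e0]; ring

end Algebra

section FourNodes

variable {V : Type*} [AddCommGroup V] [Module ℂ V] {T : V →ₗ[ℂ] V →ₗ[ℂ] V →ₗ[ℂ] ℂ}
  {p : Fin 4 → V}

/-- The singular points of a cubic form with polarization `T` are, up to scaling, exactly the four
pairwise non-proportional vectors `p k`. -/
structure IsFourSingular (T : V →ₗ[ℂ] V →ₗ[ℂ] V →ₗ[ℂ] ℂ) (p : Fin 4 → V) : Prop where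
  symm₁₂ : ∀ x y z, T x y z = T y x z
  symm₂₃ : ∀ x y z, T x y z = T x z y
  ne_zero : ∀ k, p k ≠ 0
  ne_smul : ∀ k l, k ≠ l → ∀ c : ℂ, p k ≠ c • p l
  sing : ∀ k z, T (p k) (p k) z = 0
  only : ∀ x, x ≠ 0 → (∀ z, T x x z = 0) → ∃ (k : Fin 4) (c : ℂ), x = c • p k

namespace IsFourSingular

theorem smul_add_smul (h : IsFourSingular T p) {i j : Fin 4} (hij : i ≠ j) {a b : ℂ}
    (hab : a • p i + b • p j = 0) : a = 0 ∧ b = 0 := by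
  have ha : a = 0 := by
    by_contra ha
    refine h.ne_smul i j hij (-(a⁻¹ * b)) ?_
    have := congrArg (a⁻¹ • ·) hab
    simp only [smul_add, smul_smul, inv_mul_cancel₀ ha, one_smul, smul_zero] at this
    rw [neg_smul]
    exact eq_neg_of_add_eq_zero_left this
  subst ha
  simpa [h.ne_zero j] using hab

theorem polar_pair_ne_zero (h : IsFourSingular T p) {i j : Fin 4} (hij : i ≠ j) :
    T (p i) (p j) ≠ 0 := by
  intro h0
  have h1 : ∀ s : ℂ, ∃ (k : Fin 4) (c : ℂ), p i + s • p j = c • p k := fun s => by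
    refine h.only _ (fun hs => ?_) fun z => ?_
    · simpa using (h.smul_add_smul hij (a := 1) (by simpa using hs)).1
    · have h0' : T (p j) (p i) z = 0 := by rw [h.symm₁₂, h0]; rfl
      simp [h.sing, h0, h0']
  choose k c hk using h1
  obtain ⟨s, s', hne, hss⟩ := Finite.exists_ne_map_eq_of_infinite k
  have e : (c s' - c s) • p i + (s * c s' - s' * c s) • p j = 0 := by
    have e1 := hk s
    have e2 := hk s'
    rw [← hss] at e2
    linear_combination (norm := module) c s' • e1 - c s • e2
  obtain ⟨e1, e2⟩ := h.smul_add_smul hij e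
  have hc : c s' = c s := sub_eq_zero.1 e1
  rw [hc, ← sub_mul] at e2
  have hc0 : c s = 0 := (mul_eq_zero.1 e2).resolve_left (sub_ne_zero.2 hne)
  have := hk s
  rw [hc0, zero_smul] at this
  simpa using (h.smul_add_smul hij (a := 1) (by simpa using this)).1

theorem not_collinear (h : IsFourSingular T p) {i j k : Fin 4} (hij : i ≠ j) (hik : i ≠ k)
    (hjk : j ≠ k) (a b : ℂ) : p k ≠ a • p i + b • p j := by
  intro hk
  have ha : a ≠ 0 := by
    rintro rfl
    exact h.ne_smul k j hjk.symm b (by simpa using hk)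
  have hb : b ≠ 0 := by
    rintro rfl
    exact h.ne_smul k i hik.symm a (by simpa using hk)
  refine h.polar_pair_ne_zero hij (LinearMap.ext fun z => ?_)
  have hz := h.sing k z
  simp only [hk, map_add, map_smul, LinearMap.add_apply, LinearMap.smul_apply, h.sing, smul_eq_mul,
    h.symm₁₂ (p j) (p i)] at hz
  have : (a * b) * T (p i) (p j) z = 0 := by linear_combination hz / 2
  simpa [ha, hb] using this

theorem smul_add_smul_add_smul (h : IsFourSingular T p) {i j k : Fin 4} (hij : i ≠ j) (hik : i ≠ k)
    (hjk : j ≠ k) {a b c : ℂ} (habc : a • p i + b • p j + c • p k = 0) :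
    a = 0 ∧ b = 0 ∧ c = 0 := by
  have hc : c = 0 := by
    by_contra hc
    refine h.not_collinear hij hik hjk (-(c⁻¹ * a)) (-(c⁻¹ * b)) ?_
    have := congrArg (c⁻¹ • ·) habc
    simp only [smul_add, smul_smul, inv_mul_cancel₀ hc, one_smul, smul_zero] at this
    linear_combination (norm := module) this
  subst hc
  have := h.smul_add_smul hij (by simpa using habc)
  exact ⟨this.1, this.2, rfl⟩

theorem not_coplanar [FiniteDimensional ℂ V] (hV : Module.finrank ℂ V = 4)
    (h : IsFourSingular T p) (a b c : ℂ) : p 3 ≠ a • p 0 + b • p 1 + c • p 2 := by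
  intro hp
  have ha : a ≠ 0 := by
    rintro rfl
    exact h.not_collinear (i := 1) (j := 2) (k := 3) (by decide) (by decide) (by decide) b c
      (by simpa using hp)
  have hb : b ≠ 0 := by
    rintro rfl
    exact h.not_collinear (i := 0) (j := 2) (k := 3) (by decide) (by decide) (by decide) a c
      (by simpa using hp)
  have hc : c ≠ 0 := by
    rintro rfl
    exact h.not_collinear (i := 0) (j := 1) (k := 3) (by decide) (by decide) (by decide) a b
      (by simpa using hp)
  have hli : LinearIndependent ℂ ![p 0, p 1, p 2] := by
    rw [Fintype.linearIndependent_iff]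
    intro g hg
    have := h.smul_add_smul_add_smul (i := 0) (j := 1) (k := 2) (by decide) (by decide) (by decide)
      (a := g 0) (b := g 1) (c := g 2) (by simpa [Fin.sum_univ_three] using hg)
    intro i
    fin_cases i
    exacts [this.1, this.2.1, this.2.2]
  obtain ⟨w, hw⟩ := exists_linearIndependent_snoc_of_lt_finrank hli (by omega)
  let B := basisOfLinearIndependentOfCardEqFinrank hw (by simp [hV])
  have hext : ∀ f : V →ₗ[ℂ] ℂ, f (p 0) = 0 → f (p 1) = 0 → f (p 2) = 0 → f w = 0 → f = 0 := by
    intro f h0 h1 h2 h3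
    refine B.ext fun i => ?_
    simp only [B, coe_basisOfLinearIndependentOfCardEqFinrank]
    fin_cases i
    exacts [h0, h1, h2, h3]
  have h3 : ∀ z, a * b * T (p 0) (p 1) z + a * c * T (p 0) (p 2) z + b * c * T (p 1) (p 2) z = 0 := by
    intro z
    have hz := h.sing 3 z
    simp only [hp, map_add, map_smul, LinearMap.add_apply, LinearMap.smul_apply, h.sing,
      smul_eq_mul, h.symm₁₂ (p 1) (p 0), h.symm₁₂ (p 2) (p 0), h.symm₁₂ (p 2) (p 1)] at hz
    linear_combination hz / 2
  have hs : ∀ i j, T (p i) (p j) (p j) = 0 := fun i j => by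
    rw [h.symm₁₂, h.symm₂₃, h.sing]
  have hs' : ∀ i j, T (p i) (p j) (p i) = 0 := fun i j => by
    rw [h.symm₂₃, h.sing]
  have h012 : T (p 0) (p 1) (p 2) = 0 := by
    have := h3 (p 2)
    simpa [hs, hs', ha, hb] using this
  have h021 : T (p 0) (p 2) (p 1) = 0 := by rw [h.symm₂₃, h012]
  have h120 : T (p 1) (p 2) (p 0) = 0 := by rw [h.symm₂₃, h.symm₁₂, h012]
  set α := a * b * T (p 0) (p 1) w with hα
  set β := b * c * T (p 1) (p 2) w with hβ
  set γ := a * c * T (p 0) (p 2) w with hγ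
  have hsum : α + γ + β = 0 := h3 w
  have hβ0 : β ≠ 0 := by
    refine mul_ne_zero (mul_ne_zero hb hc) fun h0 => ?_
    exact h.polar_pair_ne_zero (i := 1) (j := 2) (by decide) (hext _ h120 (hs' _ _) (hs _ _) h0)
  obtain ⟨s, hsm⟩ := Infinite.exists_notMem_finset ({0, β⁻¹, -γ⁻¹} : Finset ℂ)
  simp only [Finset.mem_insert, Finset.mem_singleton, not_or] at hsm
  obtain ⟨hs0, hsβ, hsγ⟩ := hsm
  set m := 1 - s * β with hm
  set n := 1 + s * γ with hn
  have hm0 : m ≠ 0 := fun h0 => hsβ (by field_simp; linear_combination -h0)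
  have hn0 : n ≠ 0 := fun h0 => by
    have hγ0 : γ ≠ 0 := fun hγ0 => by simp [hn, hγ0] at h0
    exact hsγ (by field_simp; linear_combination h0)
  have key : ∀ z, T ((m * a) • p 0 + (n * b) • p 1 + (n * m * c) • p 2)
      ((m * a) • p 0 + (n * b) • p 1 + (n * m * c) • p 2) z = 0 := by
    have : T ((m * a) • p 0 + (n * b) • p 1 + (n * m * c) • p 2)
      ((m * a) • p 0 + (n * b) • p 1 + (n * m * c) • p 2) = 0 := by
      apply hext
      all_goals
        simp only [map_add, map_smul, LinearMap.add_apply, LinearMap.smul_apply, h.sing,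
          smul_eq_mul, h.symm₁₂ (p 1) (p 0), h.symm₁₂ (p 2) (p 0), h.symm₁₂ (p 2) (p 1),
          h012, h021, h120, hs, hs']
      any_goals ring1
      have e : m * n * (α + m * γ + n * β) = 0 := by
        rw [hm, hn]; linear_combination (1 - s * β) * (1 + s * γ) * hsum
      rw [hα, hβ, hγ] at e
      linear_combination 2 * e
    intro z
    rw [this]; rfl
  have hind : ∀ {x y z : ℂ}, x • p 0 + y • p 1 + z • p 2 = 0 → x = 0 ∧ y = 0 ∧ z = 0 :=
    h.smul_add_smul_add_smul (by decide) (by decide) (by decide)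
  obtain ⟨k, d, hk⟩ := h.only _ (fun h0 => mul_ne_zero hm0 ha (hind h0).1) key
  obtain rfl | rfl | rfl | rfl : k = 0 ∨ k = 1 ∨ k = 2 ∨ k = 3 := by omega
  · have := hind (x := m * a - d) (y := n * b) (z := n * m * c)
      (by linear_combination (norm := module) hk)
    exact mul_ne_zero hn0 hb this.2.1
  · have := hind (x := m * a) (y := n * b - d) (z := n * m * c)
      (by linear_combination (norm := module) hk)
    exact mul_ne_zero hm0 ha this.1
  · have := hind (x := m * a) (y := n * b) (z := n * m * c - d)
      (by linear_combination (norm := module) hk)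
    exact mul_ne_zero hm0 ha this.1
  · have := hind (x := m * a - d * a) (y := n * b - d * b) (z := n * m * c - d * c) (by
      have hk' : (m * a) • p 0 + (n * b) • p 1 + (n * m * c) • p 2 = d • p 3 := hk
      rw [hp] at hk'
      linear_combination (norm := module) hk')
    obtain ⟨e0, e1, e2⟩ := this
    have e0' : m = d := mul_right_cancel₀ ha (sub_eq_zero.1 e0)
    have e1' : n = d := mul_right_cancel₀ hb (sub_eq_zero.1 e1)
    have e2' : n * m = d := mul_right_cancel₀ hc (sub_eq_zero.1 e2)
    have hm1 : m = 1 := by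
      refine mul_left_cancel₀ hn0 ?_
      rw [e2', mul_one, e1']
    have : s * β = 0 := by linear_combination -hm1
    exact mul_ne_zero hs0 hβ0 this

theorem linearIndependent [FiniteDimensional ℂ V] (hV : Module.finrank ℂ V = 4)
    (h : IsFourSingular T p) : LinearIndependent ℂ p := by
  rw [Fintype.linearIndependent_iff]
  intro g hg
  rw [Fin.sum_univ_four] at hg
  have h3 : g 3 = 0 := by
    by_contra h3
    refine h.not_coplanar hV (-((g 3)⁻¹ * g 0)) (-((g 3)⁻¹ * g 1)) (-((g 3)⁻¹ * g 2)) ?_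
    have := congrArg ((g 3)⁻¹ • ·) hg
    simp only [smul_add, smul_smul, inv_mul_cancel₀ h3, one_smul, smul_zero] at this
    linear_combination (norm := module) this
  have := h.smul_add_smul_add_smul (i := 0) (j := 1) (k := 2) (by decide) (by decide) (by decide)
    (by simpa [h3] using hg)
  intro i
  fin_cases i
  exacts [this.1, this.2.1, this.2.2, h3]

theorem polar_triple_ne_zero [FiniteDimensional ℂ V] (hV : Module.finrank ℂ V = 4)
    (h : IsFourSingular T p)
    (hnode : ∀ k x, (∀ y, T (p k) x y = 0) → ∃ c : ℂ, x = c • p k)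
    {i j k l : Fin 4} (hij : i ≠ j) (hik : i ≠ k) (hjk : j ≠ k)
    (hall : ∀ m, m = i ∨ m = j ∨ m = k ∨ m = l) : T (p i) (p j) (p k) ≠ 0 := by
  intro h0
  let B := basisOfLinearIndependentOfCardEqFinrank (h.linearIndependent hV) (by simp [hV])
  have hext : ∀ f : V →ₗ[ℂ] ℂ, f (p i) = 0 → f (p j) = 0 → f (p k) = 0 → f (p l) = 0 → f = 0 := by
    intro f h0 h1 h2 h3
    refine B.ext fun m => ?_
    simp only [B, coe_basisOfLinearIndependentOfCardEqFinrank]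
    rcases hall m with rfl | rfl | rfl | rfl
    exacts [h0, h1, h2, h3]
  have hs : ∀ i j, T (p i) (p j) (p j) = 0 := fun i j => by
    rw [h.symm₁₂, h.symm₂₃, h.sing]
  have hs' : ∀ i j, T (p i) (p j) (p i) = 0 := fun i j => by
    rw [h.symm₂₃, h.sing]
  have h0' : T (p i) (p k) (p j) = 0 := by rw [h.symm₂₃, h0]
  have hker : T (p i) (T (p i) (p k) (p l) • p j - T (p i) (p j) (p l) • p k) = 0 := by
    apply hext
    all_goals simp only [map_sub, map_smul, LinearMap.sub_apply, LinearMap.smul_apply, hs, hs', h0,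
      h0', smul_eq_mul]
    all_goals ring
  obtain ⟨c, hc⟩ := hnode i _ fun y => by rw [hker]; rfl
  have := h.smul_add_smul_add_smul hij hik hjk (a := -c) (b := T (p i) (p k) (p l))
    (c := -T (p i) (p j) (p l)) (by linear_combination (norm := module) hc)
  exact h.polar_pair_ne_zero hij (hext _ (hs' _ _) (hs _ _) h0 (neg_eq_zero.1 this.2.2))

end IsFourSingular

end FourNodes

section Cayley

/-- The coordinate polynomials of a basis of `Fin 4 → ℂ`. -/
noncomputable def coordForm (q : Module.Basis (Fin 4) ℂ (Fin 4 → ℂ)) (k : Fin 4) :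
    MvPolynomial (Fin 4) ℂ :=
  linForm (q.coord k)

variable {q : Module.Basis (Fin 4) ℂ (Fin 4 → ℂ)}

theorem eval_coordForm (k : Fin 4) (x : Fin 4 → ℂ) : eval x (coordForm q k) = q.repr x k := by
  rw [coordForm, eval_linForm, Module.Basis.coord_apply]

theorem coordForm_isHomogeneous (k : Fin 4) : (coordForm q k).IsHomogeneous 1 :=
  linForm_isHomogeneous _

variable (q) in
/-- The vertices of the triangle cut out on `e₃(Z) = 0` by the plane `e₁(Z) = 0`, where `Z` are
the coordinates with respect to `q`. -/
noncomputable def triangleVertex (t : Fin 3) : Fin 4 → ℂ :=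
  q.equivFun.symm (![![1, 1, -1, -1], ![1, -1, 1, -1], ![1, -1, -1, 1]] t)

theorem eval_triangleVertex (t : Fin 3) (k : Fin 4) :
    eval (triangleVertex q t) (coordForm q k) =
      (![![1, 1, -1, -1], ![1, -1, 1, -1], ![1, -1, -1, 1]] : Fin 3 → Fin 4 → ℂ) t k := by
  rw [eval_coordForm, triangleVertex, ← q.equivFun_apply, LinearEquiv.apply_symm_apply]

theorem surjective_eval_nodes_vertices {p : Fin 4 → (Fin 4 → ℂ)} {c : Fin 4 → ℂ}
    (hc : ∀ k, c k ≠ 0) (hp : ∀ k, p k = c k • q k) :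
    Function.Surjective (fun (G : homogeneousSubmodule (Fin 4) ℂ 3) =>
      Sum.elim (fun k : Fin 4 => eval (p k) (G : MvPolynomial (Fin 4) ℂ))
        (fun t : Fin 3 => eval (triangleVertex q t) (G : MvPolynomial (Fin 4) ℂ))) := by
  intro y
  have hev : ∀ k l, eval (p k) (coordForm q l) = if k = l then c k else 0 := fun k l => by
    rw [eval_coordForm, hp]
    simp [Finsupp.single_apply]
  let Z := coordForm q
  have hZ : ∀ k, (Z k).IsHomogeneous 1 := coordForm_isHomogeneous
  let a : Fin 4 → ℂ := fun k => y (.inl k) / c k ^ 3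
  let b : Fin 3 → ℂ := ![
    (a 0 + a 1 - a 2 - a 3 - y (.inr 0)) / 2,
    (a 0 - a 1 + a 2 - a 3 - y (.inr 1)) / 2,
    (a 0 - a 1 - a 2 + a 3 - y (.inr 2)) / 2]
  let G : MvPolynomial (Fin 4) ℂ :=
    (C (a 0) * Z 0 ^ 3 + C (a 1) * Z 1 ^ 3 + C (a 2) * Z 2 ^ 3 + C (a 3) * Z 3 ^ 3) +
    (C (b 0) * (Z 0 * Z 1 * (Z 2 + Z 3)) + C (b 1) * (Z 0 * Z 2 * (Z 1 + Z 3)) +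
      C (b 2) * (Z 0 * Z 3 * (Z 1 + Z 2)))
  have hcube : ∀ k, (C (a k) * Z k ^ 3).IsHomogeneous 3 := fun k => by
    simpa using (isHomogeneous_C _ (a k)).mul ((hZ k).pow 3)
  have hprod : ∀ r i j k, (C (b r) * (Z 0 * Z i * (Z j + Z k))).IsHomogeneous 3 :=
    fun r i j k => by
    simpa using (isHomogeneous_C _ (b r)).mul (((hZ 0).mul (hZ i)).mul ((hZ j).add (hZ k)))
  have hG : G.IsHomogeneous 3 :=
    ((((hcube 0).add (hcube 1)).add (hcube 2)).add (hcube 3)).add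
      (((hprod 0 1 2 3).add (hprod 1 2 1 3)).add (hprod 2 3 1 2))
  refine ⟨⟨G, hG⟩, funext fun i => ?_⟩
  rcases i with k | t
  · have ha : a k * c k ^ 3 = y (.inl k) := div_mul_cancel₀ _ (pow_ne_zero 3 (hc k))
    change eval (p k) G = _
    rw [← ha]
    obtain rfl | rfl | rfl | rfl : k = 0 ∨ k = 1 ∨ k = 2 ∨ k = 3 := by omega
    all_goals simp [G, Z, hev]
  · change eval (triangleVertex q t) G = _
    obtain rfl | rfl | rfl : t = 0 ∨ t = 1 ∨ t = 2 := by omega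
    all_goals
      simp only [G, Z, map_add, map_mul, map_pow, eval_C, eval_triangleVertex]
      simp [b]
      ring

theorem cayley_triangle_of_eval_eq {F : MvPolynomial (Fin 4) ℂ} {p : Fin 4 → (Fin 4 → ℂ)}
    {c : Fin 4 → ℂ} (hc : ∀ k, c k ≠ 0) (hp : ∀ k, p k = c k • q k) {P : ℂ} (hP : P ≠ 0)
    (hF : ∀ x, eval x F = P * (q.repr x 1 * q.repr x 2 * q.repr x 3 +
      q.repr x 0 * q.repr x 2 * q.repr x 3 + q.repr x 0 * q.repr x 1 * q.repr x 3 +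
      q.repr x 0 * q.repr x 1 * q.repr x 2)) :
    ∃ (L : MvPolynomial (Fin 4) ℂ) (M : Fin 3 → MvPolynomial (Fin 4) ℂ),
      L.IsHomogeneous 1 ∧ (∀ i, (M i).IsHomogeneous 1) ∧
      LinearIndependent ℂ (Fin.cons L M : Fin 4 → MvPolynomial (Fin 4) ℂ) ∧
      (∀ k, eval (p k) L ≠ 0) ∧
      (∃ Q : MvPolynomial (Fin 4) ℂ, Q.IsHomogeneous 2 ∧
        F = M 0 * M 1 * M 2 + Q * L) ∧
      ∃ v : Fin 3 → (Fin 4 → ℂ),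
        (∀ t, v t ≠ 0) ∧
        (∀ t, eval (v t) L = 0) ∧
        (∀ t s, s ≠ t → eval (v t) (M s) = 0) ∧
        Function.Surjective (fun (G : homogeneousSubmodule (Fin 4) ℂ 3) =>
          Sum.elim (fun k : Fin 4 => eval (p k) (G : MvPolynomial (Fin 4) ℂ))
                   (fun t : Fin 3 => eval (v t) (G : MvPolynomial (Fin 4) ℂ))) := by
  let Z := coordForm q
  have hZ : ∀ k, (Z k).IsHomogeneous 1 := coordForm_isHomogeneous
  let L := Z 0 + Z 1 + Z 2 + Z 3
  let M : Fin 3 → MvPolynomial (Fin 4) ℂ := ![C P * (Z 0 + Z 1), Z 0 + Z 2, Z 0 + Z 3]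
  have hLp : ∀ k, eval (p k) L ≠ 0 := fun k => by
    have : eval (p k) L = c k := by
      simp only [L, Z, map_add, eval_coordForm, hp]
      obtain rfl | rfl | rfl | rfl : k = 0 ∨ k = 1 ∨ k = 2 ∨ k = 3 := by omega
      all_goals simp
    rw [this]
    exact hc k
  have hLv : ∀ t, eval (triangleVertex q t) L = 0 := fun t => by
    simp only [L, Z, map_add, eval_triangleVertex]
    fin_cases t <;> simp
  have hMv : ∀ t s, s ≠ t → eval (triangleVertex q t) (M s) = 0 := fun t s hst => by
    fin_cases t <;> fin_cases s <;> simp [M, Z, eval_triangleVertex] at hst ⊢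
  have hMv' : ∀ t, eval (triangleVertex q t) (M t) ≠ 0 := fun t => by
    fin_cases t <;> simp [M, Z, eval_triangleVertex, hP]
  refine ⟨L, M, (((hZ 0).add (hZ 1)).add (hZ 2)).add (hZ 3), fun i => ?_, ?_, hLp,
    ⟨-(C P * Z 0 ^ 2), ?_, ?_⟩, triangleVertex q, fun t h0 => ?_, hLv, hMv,
    surjective_eval_nodes_vertices hc hp⟩
  · fin_cases i
    · simpa [M] using (isHomogeneous_C _ P).mul ((hZ 0).add (hZ 1))
    · exact (hZ 0).add (hZ 2)
    · exact (hZ 0).add (hZ 3)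
  · rw [Fintype.linearIndependent_iff]
    intro g hg
    rw [Fin.sum_univ_succ] at hg
    simp only [Fin.cons_zero, Fin.cons_succ] at hg
    have hs : ∀ t : Fin 3, g t.succ = 0 := fun t => by
      have := congrArg (eval (triangleVertex q t)) hg
      simp only [map_add, map_sum, smul_eval, hLv, mul_zero, zero_add, map_zero] at this
      rw [Finset.sum_eq_single t (fun s _ hs => by rw [hMv t s hs, mul_zero]) (by simp)] at this
      exact (mul_eq_zero.1 this).resolve_right (hMv' t)
    have h0 : g 0 = 0 := by
      have := congrArg (eval (p 0)) hg
      simp only [hs, zero_smul, Finset.sum_const_zero, add_zero, smul_eval, map_zero] at this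
      exact (mul_eq_zero.1 this).resolve_right (hLp 0)
    exact Fin.cases h0 hs
  · simpa using ((isHomogeneous_C _ P).mul ((hZ 0).pow 2)).neg
  · refine MvPolynomial.funext fun x => ?_
    rw [hF]
    simp [M, L, Z, eval_coordForm]
    ring
  · have h := eval_triangleVertex (q := q) t 0
    rw [h0, eval_coordForm, map_zero q.repr, Finsupp.zero_apply] at h
    fin_cases t <;> simp at h

end Cayley

/-- A four-nodal cubic surface `X = V(F) ⊂ ℙ³` has a plane section, avoiding the four
nodes, consisting of three distinct lines not in a pencil (cut out on the plane `V(L)`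
by the three linear forms `M 0, M 1, M 2`, with `L, M 0, M 1, M 2` linearly independent);
moreover the four nodes together with the three vertices of this triangle impose
independent conditions on cubics in `ℙ³`. -/
theorem cayley_cubic_triangle (F : MvPolynomial (Fin 4) ℂ) (hF : F.IsHomogeneous 3)
    (p : Fin 4 → (Fin 4 → ℂ)) (hp0 : ∀ k, p k ≠ 0)
    (hpdist : ∀ k l, k ≠ l → ¬ ∃ c : ℂ, p k = c • p l)
    (hsing : ∀ (k : Fin 4) (j : Fin 4), eval (p k) (pderiv j F) = 0)
    (hnode : ∀ k, (Matrix.of fun i j : Fin 4 =>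
      eval (p k) (pderiv i (pderiv j F))).rank = 3)
    (honly : ∀ x : Fin 4 → ℂ, x ≠ 0 → (∀ j, eval x (pderiv j F) = 0) →
      ∃ (k : Fin 4) (c : ℂ), x = c • p k) :
    ∃ (L : MvPolynomial (Fin 4) ℂ) (M : Fin 3 → MvPolynomial (Fin 4) ℂ),
      L.IsHomogeneous 1 ∧ (∀ i, (M i).IsHomogeneous 1) ∧
      LinearIndependent ℂ (Fin.cons L M : Fin 4 → MvPolynomial (Fin 4) ℂ) ∧
      (∀ k, eval (p k) L ≠ 0) ∧
      (∃ Q : MvPolynomial (Fin 4) ℂ, Q.IsHomogeneous 2 ∧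
        F = M 0 * M 1 * M 2 + Q * L) ∧
      ∃ v : Fin 3 → (Fin 4 → ℂ),
        (∀ t, v t ≠ 0) ∧
        (∀ t, eval (v t) L = 0) ∧
        (∀ t s, s ≠ t → eval (v t) (M s) = 0) ∧
        Function.Surjective (fun (G : homogeneousSubmodule (Fin 4) ℂ 3) =>
          Sum.elim (fun k : Fin 4 => eval (p k) (G : MvPolynomial (Fin 4) ℂ))
                   (fun t : Fin 3 => eval (v t) (G : MvPolynomial (Fin 4) ℂ))) := by
  have hpk : ∀ k l, k ≠ l → ∀ c : ℂ, p k ≠ c • p l := fun k l hkl c h => hpdist k l hkl ⟨c, h⟩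
  obtain ⟨T, hT12, hT23, hT2, hT1, hT0⟩ := exists_polarization F hF
  have hS : IsFourSingular T p := by
    refine ⟨hT12, hT23, hp0, hpk, fun k z => ?_, fun x hx hxT => honly x hx fun j => ?_⟩
    · simp [hT1, hsing]
    · have := hxT (Pi.single j 1)
      rw [hT1] at this
      simpa [Pi.single_apply] using this
  have hV : Module.finrank ℂ (Fin 4 → ℂ) = 4 := by simp
  have hker : ∀ k x, (∀ y, T (p k) x y = 0) → ∃ c : ℂ, x = c • p k := by
    intro k x hx
    set H := Matrix.of fun i j : Fin 4 => eval (p k) (pderiv i (pderiv j F)) with hH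
    have hmem : ∀ x, (∀ y, T (p k) x y = 0) → x ∈ LinearMap.ker H.mulVecLin := by
      intro x hx
      rw [LinearMap.mem_ker]
      ext i
      have := hx (Pi.single i 1)
      rw [hT23, hT2] at this
      simpa [Pi.single_apply, Matrix.mulVec, dotProduct, hH, mul_comm] using this
    have hfr : Module.finrank ℂ (LinearMap.ker H.mulVecLin) = 1 := by
      have h1 := H.mulVecLin.finrank_range_add_finrank_ker
      have h2 : Module.finrank ℂ (LinearMap.range H.mulVecLin) = 3 := hnode k
      omega
    have hpm : p k ∈ LinearMap.ker H.mulVecLin := hmem _ (hS.sing k)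
    obtain ⟨c, hc⟩ := (finrank_eq_one_iff_of_nonzero' (⟨p k, hpm⟩ : LinearMap.ker H.mulVecLin)
      (by simpa [Subtype.ext_iff] using hp0 k)).1 hfr ⟨x, hmem x hx⟩
    exact ⟨c, (congrArg Subtype.val hc).symm⟩
  let t : Fin 4 → ℂ :=
    ![T (p 1) (p 2) (p 3), T (p 0) (p 2) (p 3), T (p 0) (p 1) (p 3), T (p 0) (p 1) (p 2)]
  have ht : ∀ k, t k ≠ 0 := by
    intro k
    fin_cases k
    · exact hS.polar_triple_ne_zero hV hker (l := 0) (by decide) (by decide) (by decide) (by decide)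
    · exact hS.polar_triple_ne_zero hV hker (l := 1) (by decide) (by decide) (by decide) (by decide)
    · exact hS.polar_triple_ne_zero hV hker (l := 2) (by decide) (by decide) (by decide) (by decide)
    · exact hS.polar_triple_ne_zero hV hker (l := 3) (by decide) (by decide) (by decide) (by decide)
  let B := basisOfLinearIndependentOfCardEqFinrank (hS.linearIndependent hV) (by simp)
  let q := B.isUnitSMul fun k => (ht k).isUnit
  have hq : ∀ k, q k = t k • p k := fun k => by simp [q, B, Module.Basis.isUnitSMul_apply]
  refine cayley_triangle_of_eval_eq (q := q) (c := fun k => (t k)⁻¹) (fun k => inv_ne_zero (ht k))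
    (fun k => by rw [hq, smul_smul, inv_mul_cancel₀ (ht k), one_smul])
    (P := t 0 * t 1 * t 2 * t 3)
    (mul_ne_zero (mul_ne_zero (mul_ne_zero (ht 0) (ht 1)) (ht 2)) (ht 3)) fun x => ?_
  have hx : x = (q.repr x 0 * t 0) • p 0 + (q.repr x 1 * t 1) • p 1 + (q.repr x 2 * t 2) • p 2 +
      (q.repr x 3 * t 3) • p 3 := by
    conv_lhs => rw [← q.sum_repr x, Fin.sum_univ_four]
    simp only [hq, smul_smul]
  generalize q.repr x 0 = y0 at *
  generalize q.repr x 1 = y1 at *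
  generalize q.repr x 2 = y2 at *
  generalize q.repr x 3 = y3 at *
  have hs : ∀ i j, T (p i) (p j) (p j) = 0 := fun i j => by rw [hT12, hT23, hS.sing]
  have hs' : ∀ i j, T (p i) (p j) (p i) = 0 := fun i j => by rw [hT23, hS.sing]
  have h6 := hT0 x
  rw [hx] at h6 ⊢
  simp only [map_add, map_smul, LinearMap.add_apply, LinearMap.smul_apply, smul_eq_mul, hS.sing,
    hs, hs', hT12 (p 1) (p 0), hT12 (p 2) (p 0), hT12 (p 3) (p 0), hT12 (p 2) (p 1),
    hT12 (p 3) (p 1), hT12 (p 3) (p 2), hT23 _ (p 2) (p 0), hT23 _ (p 3) (p 0),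
    hT23 _ (p 2) (p 1), hT23 _ (p 3) (p 1), hT23 _ (p 3) (p 2)] at h6
  have t0 : T (p 1) (p 2) (p 3) = t 0 := rfl
  have t1 : T (p 0) (p 2) (p 3) = t 1 := rfl
  have t2 : T (p 0) (p 1) (p 3) = t 2 := rfl
  have t3 : T (p 0) (p 1) (p 2) = t 3 := rfl
  rw [t0, t1, t2, t3] at h6
  linear_combination -h6 / 6
end

section
/- Let p₁, p₂, p₃, p₄ ∈ ℙ³ be four points not contained in any plane, and let H ⊂ ℙ³ be a plane containing none of them. Then the restriction map from the space of homogeneous degree-3 polynomials in ℂ[X₀,X₁,X₂,X₃] vanishing at p₁, p₂, p₃, p₄ to the space of degree-3 forms on H ≅ ℙ² is surjective; equivalently, choosing coordinates so that H = {X₃ = 0}, for every homogeneous cubic g ∈ ℂ[X₀,X₁,X₂] there exists a homogeneous cubic G ∈ ℂ[X₀,X₁,X₂,X₃] vanishing at p₁, p₂, p₃, p₄ with G(X₀,X₁,X₂,0) = g. -/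
open MvPolynomial

/-- Linear forms dual to a linearly independent family of `card σ` points. -/
theorem exists_linear_forms_dual {σ K : Type*} [Fintype σ] [DecidableEq σ] [Field K]
    {p : σ → σ → K} (hp : LinearIndependent K p) :
    ∃ L : σ → MvPolynomial σ K, (∀ k, (L k).IsHomogeneous 1) ∧
      ∀ j k, eval (p j) (L k) = if j = k then 1 else 0 := by
  have hunit : IsUnit (Matrix.of p) := Matrix.linearIndependent_rows_iff_isUnit.mp hp
  have hdet := (Matrix.isUnit_iff_isUnit_det _).mp hunit
  refine ⟨fun k => ∑ i, C ((Matrix.of p)⁻¹ i k) * X i, fun k => ?_, fun j k => ?_⟩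
  · exact IsHomogeneous.sum _ _ _ fun i _ => isHomogeneous_C_mul_X _ i
  · have h := congrFun (congrFun (Matrix.mul_nonsing_inv _ hdet) j) k
    rw [Matrix.mul_apply, Matrix.one_apply] at h
    simpa [mul_comm] using h

/-- Forms of positive degree take arbitrary values on a linearly independent family of points. -/
theorem exists_isHomogeneous_eval_eq {σ K : Type*} [Fintype σ] [DecidableEq σ] [Field K]
    {p : σ → σ → K} (hp : LinearIndependent K p) {d : ℕ} (hd : d ≠ 0) (c : σ → K) :
    ∃ Q : MvPolynomial σ K, Q.IsHomogeneous d ∧ ∀ k, eval (p k) Q = c k := by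
  obtain ⟨L, hL, hLp⟩ := exists_linear_forms_dual hp
  refine ⟨∑ k, C (c k) * L k ^ d, IsHomogeneous.sum _ _ _ fun k _ => ?_, fun k => ?_⟩
  · simpa using ((hL k).pow d).C_mul (c k)
  · simp [hLp, hd, ite_pow]

/-- Given four points of `ℙ³` not contained in any plane (representatives linearly
independent) and a plane `H = {X₃ = 0}` containing none of them, every cubic form on `H`
is the restriction of a cubic form on `ℙ³` vanishing at the four points. -/
theorem restriction_of_cubics_through_four_points (p : Fin 4 → (Fin 4 → ℂ))
    (hp0 : ∀ k, p k ≠ 0)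
    (hindep : LinearIndependent ℂ p)
    (hoff : ∀ k, p k 3 ≠ 0) :
    ∀ g : MvPolynomial (Fin 3) ℂ, g.IsHomogeneous 3 →
      ∃ G : MvPolynomial (Fin 4) ℂ, G.IsHomogeneous 3 ∧
        (∀ k, eval (p k) G = 0) ∧
        aeval (![X 0, X 1, X 2, 0] : Fin 4 → MvPolynomial (Fin 3) ℂ) G = g := by
  intro g hg
  let g' : MvPolynomial (Fin 4) ℂ := rename Fin.castSucc g
  obtain ⟨Q, hQ, hQp⟩ := exists_isHomogeneous_eval_eq hindep two_ne_zero
    fun k => -eval (p k) g' / p k 3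
  refine ⟨g' + X 3 * Q, ?_, fun k => ?_, ?_⟩
  · exact hg.rename_isHomogeneous.add ((isHomogeneous_X ℂ 3).mul hQ)
  · simp [hQp, mul_div_cancel₀ _ (hoff k)]
  · have hX : (![X 0, X 1, X 2, 0] : Fin 4 → MvPolynomial (Fin 3) ℂ) ∘ Fin.castSucc = X := by
      funext i
      fin_cases i <;> rfl
    rw [map_add, map_mul, aeval_X, aeval_rename, hX, aeval_X_left_apply]
    simp
end

section
/- Let n ≥ 3 and write 3n − 4 = 2ℓ + ε with ε ∈ {0,1}. Fix a point q ∈ ℙ². Then there exist ℓ + ε points q₁, …, q_{ℓ+ε} ∈ ℙ², all distinct from q and pairwise distinct, such that the ℂ-vector space of homogeneous polynomials of degree 3n−2−ℓ in ℂ[x,y,z] having multiplicity at least 3n−6−ℓ at q and multiplicity at least 2 at each of q₁, …, q_{ℓ+ε} has dimension exactly 3n + ε + 1; that is, the ℓ + ε double points impose independent conditions (3(ℓ+ε) conditions) on the linear system of plane curves of degree 3n−2−ℓ with a point of multiplicity at least 3n−6−ℓ at q. -/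
open MvPolynomial

/-- The iterated partial derivative operator associated to a list of variables,
as a `ℂ`-linear endomorphism of `ℂ[x,y,z]`. -/
noncomputable def derivList (js : List (Fin 3)) :
    MvPolynomial (Fin 3) ℂ →ₗ[ℂ] MvPolynomial (Fin 3) ℂ :=
  js.foldl (fun L j => (pderiv j).toLinearMap.comp L) LinearMap.id

/-- The subspace of polynomials in `ℂ[x,y,z]` having multiplicity at least `m` at the
point `p`, i.e. all of whose partial derivatives of order `< m` vanish at `p`. -/
noncomputable def multCond (m : ℕ) (p : Fin 3 → ℂ) :
    Submodule ℂ (MvPolynomial (Fin 3) ℂ) :=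
  ⨅ js ∈ {js : List (Fin 3) | js.length < m},
    LinearMap.ker ((aeval p).toLinearMap.comp (derivList js))

theorem mem_multCond {m : ℕ} {p : Fin 3 → ℂ} {f : MvPolynomial (Fin 3) ℂ} :
    f ∈ multCond m p ↔ ∀ js : List (Fin 3), js.length < m → aeval p (derivList js f) = 0 := by
  simp [multCond]

theorem derivList_cons (j : Fin 3) (js : List (Fin 3)) (f : MvPolynomial (Fin 3) ℂ) :
    derivList (j :: js) f = derivList js (pderiv j f) := by
  have key : ∀ (js : List (Fin 3)) (L : MvPolynomial (Fin 3) ℂ →ₗ[ℂ] MvPolynomial (Fin 3) ℂ),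
      js.foldl (fun L j => (pderiv j).toLinearMap.comp L) L = (derivList js).comp L := by
    intro js
    induction js with
    | nil => intro L; rfl
    | cons j js ih =>
      intro L
      simp only [derivList, List.foldl_cons] at ih ⊢
      rw [ih, ih ((pderiv j).toLinearMap.comp LinearMap.id)]
      rfl
  exact DFunLike.congr_fun (key js ((pderiv j).toLinearMap.comp LinearMap.id)) f

theorem mem_multCond_zero {p : Fin 3 → ℂ} (f : MvPolynomial (Fin 3) ℂ) : f ∈ multCond 0 p := by
  simp [mem_multCond]

theorem mem_multCond_succ {m : ℕ} {p : Fin 3 → ℂ} {f : MvPolynomial (Fin 3) ℂ} :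
    f ∈ multCond (m + 1) p ↔ aeval p f = 0 ∧ ∀ j, pderiv j f ∈ multCond m p := by
  simp only [mem_multCond]
  constructor
  · intro h
    refine ⟨h [] (by simp), fun j js hjs => ?_⟩
    rw [← derivList_cons]
    exact h _ (by simpa using hjs)
  · rintro ⟨h0, h⟩ (_ | ⟨j, js⟩) hjs
    · exact h0
    · rw [derivList_cons]
      exact h j js (by simpa using hjs)

theorem mem_multCond_one {p : Fin 3 → ℂ} {f : MvPolynomial (Fin 3) ℂ} :
    f ∈ multCond 1 p ↔ aeval p f = 0 := by
  simp [mem_multCond_succ, mem_multCond_zero]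

theorem multCond_anti {a b : ℕ} (h : a ≤ b) (p : Fin 3 → ℂ) : multCond b p ≤ multCond a p :=
  fun _ hf => mem_multCond.2 fun js hjs => mem_multCond.1 hf js (hjs.trans_le h)

theorem mul_mem_multCond {p : Fin 3 → ℂ} {a b : ℕ} {f g : MvPolynomial (Fin 3) ℂ}
    (hf : f ∈ multCond a p) (hg : g ∈ multCond b p) : f * g ∈ multCond (a + b) p := by
  induction hk : a + b generalizing a b f g with
  | zero => exact mem_multCond_zero _
  | succ k ih =>
    refine mem_multCond_succ.2 ⟨?_, fun j => ?_⟩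
    · rw [map_mul]
      rcases a with _ | a
      · obtain rfl : b = k + 1 := by omega
        rw [(mem_multCond_succ.1 hg).1, mul_zero]
      · rw [(mem_multCond_succ.1 hf).1, zero_mul]
    · rw [pderiv_mul]
      refine add_mem ?_ ?_
      · rcases a with _ | a
        · exact ih (mem_multCond_zero _) (multCond_anti (by omega) p hg) (zero_add k)
        · exact ih ((mem_multCond_succ.1 hf).2 j) hg (by omega)
      · rcases b with _ | b
        · exact ih (multCond_anti (by omega) p hf) (mem_multCond_zero _) (add_zero k)
        · exact ih hf ((mem_multCond_succ.1 hg).2 j) (by omega)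

theorem mul_mem_multCond_left {p : Fin 3 → ℂ} {a : ℕ} {f : MvPolynomial (Fin 3) ℂ}
    (hf : f ∈ multCond a p) (g : MvPolynomial (Fin 3) ℂ) : f * g ∈ multCond a p := by
  have h := mul_mem_multCond hf (mem_multCond_zero g)
  rwa [add_zero] at h

theorem pow_mem_multCond {p : Fin 3 → ℂ} {a : ℕ} {f : MvPolynomial (Fin 3) ℂ}
    (hf : f ∈ multCond a p) (k : ℕ) : f ^ k ∈ multCond (k * a) p := by
  induction k with
  | zero => rw [zero_mul]; exact mem_multCond_zero _
  | succ k ih => rw [pow_succ, add_mul, one_mul]; exact mul_mem_multCond ih hf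

theorem prod_mem_multCond {ι : Type*} {p : Fin 3 → ℂ} {a : ℕ} (s : Finset ι)
    {f : ι → MvPolynomial (Fin 3) ℂ} (hf : ∀ i ∈ s, f i ∈ multCond a p) :
    ∏ i ∈ s, f i ∈ multCond (s.card * a) p := by
  classical
  induction s using Finset.induction_on with
  | empty => rw [Finset.card_empty, zero_mul]; exact mem_multCond_zero _
  | insert i s hi ih =>
    rw [Finset.prod_insert hi, Finset.card_insert_of_notMem hi, add_mul, one_mul, add_comm]
    exact mul_mem_multCond (hf i (by simp)) (ih fun j hj => hf j (by simp [hj]))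

/-- A homogeneous form vanishes doubly at a point with first coordinate `1` as soon as its value
and its last two partial derivatives vanish there. -/
theorem mem_multCond_two_iff {d : ℕ} {f : MvPolynomial (Fin 3) ℂ} (hf : f.IsHomogeneous d)
    {p : Fin 3 → ℂ} (hp : p 0 = 1) :
    f ∈ multCond 2 p ↔ aeval p f = 0 ∧ aeval p (pderiv 1 f) = 0 ∧ aeval p (pderiv 2 f) = 0 := by
  rw [mem_multCond_succ]
  simp only [mem_multCond_one]
  have h := congrArg (aeval p) hf.sum_X_mul_pderiv
  simp only [Fin.sum_univ_three, map_add, map_mul, aeval_X, hp, map_nsmul] at h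
  constructor
  · exact fun ⟨h0, h'⟩ => ⟨h0, h' 1, h' 2⟩
  · rintro ⟨h0, h1, h2⟩
    rw [h0, h1, h2, smul_zero, mul_zero, mul_zero, one_mul, add_zero, add_zero] at h
    refine ⟨h0, fun j => ?_⟩
    fin_cases j
    exacts [h, h1, h2]

/-- Chain rule for a linear substitution. -/
theorem pderiv_aeval_toMvPolynomial (M : Matrix (Fin 3) (Fin 3) ℂ) (j : Fin 3)
    (f : MvPolynomial (Fin 3) ℂ) :
    pderiv j (aeval M.toMvPolynomial f) =
      ∑ k, C (M k j) * aeval M.toMvPolynomial (pderiv k f) := by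
  induction f using MvPolynomial.induction_on with
  | C a => simp
  | add f g hf hg => simp only [map_add, hf, hg, mul_add, Finset.sum_add_distrib]
  | mul_X f i hf =>
    have hX : pderiv j (M.toMvPolynomial i) = C (M i j) := by
      simp [Matrix.toMvPolynomial, map_sum, ← C_mul_X_eq_monomial, pderiv_X, Pi.single_apply]
    simp only [map_mul, aeval_X, pderiv_mul, map_add, hf, hX, pderiv_X, mul_add,
      Finset.sum_add_distrib, Finset.sum_mul, Pi.single_apply]
    simp [apply_ite, mul_left_comm, mul_comm]

theorem aeval_aeval_toMvPolynomial (M : Matrix (Fin 3) (Fin 3) ℂ) (p : Fin 3 → ℂ)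
    (f : MvPolynomial (Fin 3) ℂ) :
    aeval p (aeval M.toMvPolynomial f) = aeval (M.mulVec p) f := by
  rw [← AlgHom.comp_apply]
  congr 1
  ext i
  simp [aeval_eq_eval, Matrix.toMvPolynomial_eval_eq_apply]

theorem aeval_toMvPolynomial_mem_multCond (M : Matrix (Fin 3) (Fin 3) ℂ) {m : ℕ} {p : Fin 3 → ℂ}
    {f : MvPolynomial (Fin 3) ℂ} (hf : f ∈ multCond m (M.mulVec p)) :
    aeval M.toMvPolynomial f ∈ multCond m p := by
  induction m generalizing f with
  | zero => exact mem_multCond_zero _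
  | succ m ih =>
    rw [mem_multCond_succ] at hf ⊢
    refine ⟨by rw [aeval_aeval_toMvPolynomial, hf.1], fun j => ?_⟩
    rw [pderiv_aeval_toMvPolynomial]
    refine sum_mem fun k _ => ?_
    rw [← smul_eq_C_mul]
    exact Submodule.smul_mem _ _ (ih (hf.2 k))

/-- The linear change of coordinates given by a pair of mutually inverse matrices. -/
noncomputable def substEquiv (M M' : Matrix (Fin 3) (Fin 3) ℂ) (h : M * M' = 1)
    (h' : M' * M = 1) : MvPolynomial (Fin 3) ℂ ≃ₐ[ℂ] MvPolynomial (Fin 3) ℂ :=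
  AlgEquiv.ofAlgHom (aeval M.toMvPolynomial) (aeval M'.toMvPolynomial)
    (by
      ext1 i
      rw [AlgHom.comp_apply, aeval_X, AlgHom.id_apply]
      have := Matrix.toMvPolynomial_mul M' M i
      rw [h', Matrix.toMvPolynomial_one] at this
      exact this.symm)
    (by
      ext1 i
      rw [AlgHom.comp_apply, aeval_X, AlgHom.id_apply]
      have := Matrix.toMvPolynomial_mul M M' i
      rw [h, Matrix.toMvPolynomial_one] at this
      exact this.symm)

section substEquiv

variable {M M' : Matrix (Fin 3) (Fin 3) ℂ} (h : M * M' = 1) (h' : M' * M = 1)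

theorem substEquiv_mem_multCond_iff {m : ℕ} {p : Fin 3 → ℂ} {f : MvPolynomial (Fin 3) ℂ} :
    substEquiv M M' h h' f ∈ multCond m p ↔ f ∈ multCond m (M.mulVec p) := by
  refine ⟨fun hf => ?_, aeval_toMvPolynomial_mem_multCond M⟩
  have := aeval_toMvPolynomial_mem_multCond M' (p := M.mulVec p) (f := substEquiv M M' h h' f)
    (m := m) (by simpa [Matrix.mulVec_mulVec, h'] using hf)
  rwa [show aeval M'.toMvPolynomial (substEquiv M M' h h' f) = f from
    (substEquiv M M' h h').symm_apply_apply f] at this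

theorem substEquiv_isHomogeneous_iff {d : ℕ} {f : MvPolynomial (Fin 3) ℂ} :
    (substEquiv M M' h h' f).IsHomogeneous d ↔ f.IsHomogeneous d := by
  constructor
  · intro hf
    have := hf.aeval M'.toMvPolynomial M'.toMvPolynomial_isHomogeneous
    rwa [one_mul, show aeval M'.toMvPolynomial (substEquiv M M' h h' f) = f from
      (substEquiv M M' h h').symm_apply_apply f] at this
  · intro hf
    have := hf.aeval M.toMvPolynomial M.toMvPolynomial_isHomogeneous
    rwa [one_mul] at this

end substEquiv

theorem coeff_ne_zero_of_coeff_pderiv_ne_zero {f : MvPolynomial (Fin 3) ℂ} {j : Fin 3}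
    {s : Fin 3 →₀ ℕ} (h : coeff s (pderiv j f) ≠ 0) : coeff (s + Finsupp.single j 1) f ≠ 0 := by
  rw [coeff_pderiv] at h
  exact left_ne_zero_of_mul h

theorem coeff_pderiv_ne_zero {f : MvPolynomial (Fin 3) ℂ} {j : Fin 3}
    {s : Fin 3 →₀ ℕ} (hj : s j ≠ 0) (h : coeff s f ≠ 0) :
    coeff (s - Finsupp.single j 1) (pderiv j f) ≠ 0 := by
  rw [coeff_pderiv, tsub_add_cancel_of_le (by simpa [Nat.one_le_iff_ne_zero] using hj)]
  exact mul_ne_zero h (by exact Nat.cast_add_one_ne_zero _)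

theorem aeval_single_two {d : ℕ} {f : MvPolynomial (Fin 3) ℂ} (hf : f.IsHomogeneous d) :
    aeval (Pi.single 2 1 : Fin 3 → ℂ) f = coeff (Finsupp.single 2 d) f := by
  rw [aeval_def, eval₂_eq']
  rw [Finset.sum_eq_single (Finsupp.single 2 d)]
  · simp [Fin.prod_univ_three]
  · intro s hs hsd
    have hdeg : s.degree = d := by
      by_contra hne
      exact (mem_support_iff.1 hs) (hf.coeff_eq_zero hne)
    rw [Finsupp.degree_eq_sum, Fin.sum_univ_three] at hdeg
    have : s 0 ≠ 0 ∨ s 1 ≠ 0 := by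
      by_contra! hc
      apply hsd
      ext i
      fin_cases i <;> simp [hc.1, hc.2]
      omega
    rcases this with h | h <;> simp [Fin.prod_univ_three, h]
  · intro h
    simp [notMem_support_iff.1 h]

theorem mem_multCond_single_two_iff {d m : ℕ} {f : MvPolynomial (Fin 3) ℂ}
    (hf : f.IsHomogeneous d) :
    f ∈ multCond m (Pi.single 2 1) ↔ ∀ s, coeff s f ≠ 0 → m ≤ s 0 + s 1 := by
  induction m generalizing d f with
  | zero => simp [mem_multCond_zero]
  | succ m ih =>
    rw [mem_multCond_succ, aeval_single_two hf]
    simp only [fun j => ih (hf.pderiv (i := j))]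
    constructor
    · rintro ⟨h0, h⟩ s hs
      by_cases h0' : s 0 ≠ 0
      · have := h 0 _ (coeff_pderiv_ne_zero h0' hs)
        simp at this
        omega
      by_cases h1' : s 1 ≠ 0
      · have := h 1 _ (coeff_pderiv_ne_zero h1' hs)
        simp at this
        omega
      push Not at h0' h1'
      have hdeg : s.degree = d := by
        by_contra hne
        exact hs (hf.coeff_eq_zero hne)
      rw [Finsupp.degree_eq_sum, Fin.sum_univ_three] at hdeg
      refine absurd h0 (?_ : coeff _ f ≠ 0)
      convert hs
      ext i
      fin_cases i <;> simp [h0', h1']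
      omega
    · refine fun h => ⟨?_, fun j s hs => ?_⟩
      · by_contra hc
        simpa using h _ hc
      · have := h _ (coeff_ne_zero_of_coeff_pderiv_ne_zero hs)
        fin_cases j <;> simp at this <;> omega

theorem finrank_homogeneous_inf_multCond (N : ℕ) (hN : 2 ≤ N) :
    Module.finrank ℂ ↥(homogeneousSubmodule (Fin 3) ℂ (N + 2) ⊓
      multCond (N - 2) (Pi.single 2 1)) = 5 * N + 5 := by
  classical
  let F : (Σ _ : ℕ, ℕ) → (Fin 3 →₀ ℕ) := fun x =>
    Finsupp.equivFunOnFinite.symm ![x.2, N + 2 - x.1 - x.2, x.1]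
  let T : Finset (Σ _ : ℕ, ℕ) := (Finset.range 5).sigma fun k => Finset.range (N + 3 - k)
  have hW : homogeneousSubmodule (Fin 3) ℂ (N + 2) ⊓ multCond (N - 2) (Pi.single 2 1) =
      restrictSupport ℂ (T.image F : Set (Fin 3 →₀ ℕ)) := by
    ext f
    have hS : ∀ s : Fin 3 →₀ ℕ, s ∈ (T.image F : Set (Fin 3 →₀ ℕ)) ↔
        s.degree = N + 2 ∧ N - 2 ≤ s 0 + s 1 := by
      intro s
      simp only [Finset.coe_image, Set.mem_image, Finset.mem_coe, T, Finset.mem_sigma,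
        Finset.mem_range, Finsupp.degree_eq_sum, Fin.sum_univ_three]
      constructor
      · rintro ⟨⟨k, i⟩, ⟨h1, h2⟩, rfl⟩
        simp [F] at *
        omega
      · rintro ⟨h1, h2⟩
        refine ⟨⟨s 2, s 0⟩, by dsimp only; omega, ?_⟩
        ext i
        fin_cases i <;> simp [F]
        omega
    rw [mem_restrictSupport_iff, Submodule.mem_inf, mem_homogeneousSubmodule]
    constructor
    · rintro ⟨hf, hm⟩ s hs
      rw [Finset.mem_coe, mem_support_iff] at hs
      refine (hS s).2 ⟨?_, (mem_multCond_single_two_iff hf).1 hm s hs⟩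
      by_contra hne
      exact hs (hf.coeff_eq_zero hne)
    · intro h
      have h' : ∀ s, coeff s f ≠ 0 → s.degree = N + 2 ∧ N - 2 ≤ s 0 + s 1 := fun s hs =>
        (hS s).1 (h (by simpa using hs))
      have hf : f.IsHomogeneous (N + 2) := by
        intro s hs
        rw [← (h' s hs).1, Finsupp.degree_eq_weight_one]
        rfl
      exact ⟨hf, (mem_multCond_single_two_iff hf).2 fun s hs => (h' s hs).2⟩
  rw [hW, Module.finrank_eq_nat_card_basis (basisRestrictSupport ℂ _), Nat.card_coe_set_eq,
    Set.ncard_coe_finset, Finset.card_image_of_injOn, Finset.card_sigma]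
  · simp [Finset.sum_range_succ]
    omega
  · rintro ⟨k, i⟩ _ ⟨k', i'⟩ _ h
    have h0 := DFunLike.congr_fun h 0
    have h2 := DFunLike.congr_fun h 2
    simp [F] at h0 h2
    simp [h0, h2]

/-- The value and the last two partial derivatives of a polynomial at a point. -/
noncomputable def jet (p : Fin 3 → ℂ) : MvPolynomial (Fin 3) ℂ →ₗ[ℂ] (Fin 3 → ℂ) :=
  LinearMap.pi ![(aeval p).toLinearMap, (aeval p).toLinearMap ∘ₗ (pderiv 1).toLinearMap,
    (aeval p).toLinearMap ∘ₗ (pderiv 2).toLinearMap]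

theorem jet_apply (p : Fin 3 → ℂ) (f : MvPolynomial (Fin 3) ℂ) :
    jet p f = ![aeval p f, aeval p (pderiv 1 f), aeval p (pderiv 2 f)] := by
  ext i
  fin_cases i <;> rfl

theorem mem_multCond_two_iff_jet {d : ℕ} {f : MvPolynomial (Fin 3) ℂ} (hf : f.IsHomogeneous d)
    {p : Fin 3 → ℂ} (hp : p 0 = 1) : f ∈ multCond 2 p ↔ jet p f = 0 := by
  rw [mem_multCond_two_iff hf hp, jet_apply, funext_iff]
  simp [Fin.forall_fin_succ]

theorem exists_jet_mul_eq {G : MvPolynomial (Fin 3) ℂ} {p : Fin 3 → ℂ} (hp : p 0 = 1)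
    (hG : aeval p G ≠ 0) (v : Fin 3 → ℂ) :
    ∃ L : MvPolynomial (Fin 3) ℂ, L.IsHomogeneous 1 ∧ jet p (G * L) = v := by
  let w := v 0 / aeval p G
  let b := (v 1 - aeval p (pderiv 1 G) * w) / aeval p G
  let c := (v 2 - aeval p (pderiv 2 G) * w) / aeval p G
  obtain ⟨L, hL1, hL, hb, hc⟩ : ∃ L : MvPolynomial (Fin 3) ℂ, L.IsHomogeneous 1 ∧
      aeval p L = w ∧ pderiv 1 L = C b ∧ pderiv 2 L = C c := by
    refine ⟨C (w - b * p 1 - c * p 2) * X 0 + C b * X 1 + C c * X 2,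
      ((isHomogeneous_C_mul_X _ _).add (isHomogeneous_C_mul_X _ _)).add
        (isHomogeneous_C_mul_X _ _), ?_, ?_, ?_⟩
    · simp only [map_add, map_mul, algHom_C, aeval_X, hp, Algebra.algebraMap_self,
        RingHom.id_apply]
      ring
    all_goals simp only [map_add, pderiv_C_mul, pderiv_X]; simp
  refine ⟨L, hL1, ?_⟩
  have hw : aeval p G * w = v 0 := mul_div_cancel₀ _ hG
  have hb' : aeval p G * b = v 1 - aeval p (pderiv 1 G) * w := mul_div_cancel₀ _ hG
  have hc' : aeval p G * c = v 2 - aeval p (pderiv 2 G) * w := mul_div_cancel₀ _ hG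
  rw [jet_apply]
  simp only [pderiv_mul, map_add, map_mul, hL, hb, hc, algHom_C, Algebra.algebraMap_self,
    RingHom.id_apply, hw, hb', hc', add_sub_cancel]
  ext i
  fin_cases i <;> rfl

/-- Points lying alternately on two lines of the plane. -/
def zigzag (i : ℕ) : Fin 3 → ℂ := ![1, i, (i % 2 : ℕ)]

/-- The indices below `N` other than `i` whose points lie on the same line as `zigzag i`. -/
def mates (N i : ℕ) : Finset ℕ := {j ∈ Finset.range N | j % 2 = i % 2}.erase i

theorem two_mul_card_filter_mod_two {r : ℕ} (hr : r < 2) (N : ℕ) :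
    2 * {j ∈ Finset.range N | j % 2 = r}.card ≤ N + 1 := by
  have : {j ∈ Finset.range N | j % 2 = r}.card = (N + 1 - r) / 2 := by
    induction N with
    | zero => simp; omega
    | succ N ih =>
      rw [Finset.range_add_one, Finset.filter_insert]
      split_ifs with h
      · rw [Finset.card_insert_of_notMem (by simp), ih]
        omega
      · rw [ih]
        omega
  omega

theorem two_mul_card_mates {N i : ℕ} (hi : i < N) : 2 * (mates N i).card + 1 ≤ N := by
  have h := two_mul_card_filter_mod_two (Nat.mod_lt i two_pos) N
  have hmem : i ∈ {j ∈ Finset.range N | j % 2 = i % 2} := by simpa using hi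
  have := Finset.card_pos.2 ⟨i, hmem⟩
  rw [mates, Finset.card_erase_of_mem hmem]
  omega

/-- A form of degree `N + 1` which vanishes doubly at all the points `zigzag j` with `j < N` and
`j ≠ i`, but does not vanish at `zigzag i`. -/
noncomputable def separator (N i : ℕ) : MvPolynomial (Fin 3) ℂ :=
  (∏ j ∈ mates N i, (X 1 - C (j : ℂ) * X 0)) ^ 2 *
    ((X 2 - C (((i + 1) % 2 : ℕ) : ℂ) * X 0) ^ 2 * X 0 ^ (N - 1 - 2 * (mates N i).card))

theorem separator_isHomogeneous {N i : ℕ} (hi : i < N) :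
    (separator N i).IsHomogeneous (N + 1) := by
  have h1 := (IsHomogeneous.prod (mates N i) (fun j : ℕ => (X 1 - C (j : ℂ) * X 0)) (fun _ => 1)
    fun j _ => (isHomogeneous_X ℂ (1 : Fin 3)).sub (isHomogeneous_C_mul_X (j : ℂ) 0)).pow 2
  have h2 := ((isHomogeneous_X ℂ (2 : Fin 3)).sub
    (isHomogeneous_C_mul_X (((i + 1) % 2 : ℕ) : ℂ) 0)).pow 2
  have h := h1.mul (h2.mul (isHomogeneous_X_pow (R := ℂ) (0 : Fin 3)
    (N - 1 - 2 * (mates N i).card)))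
  have := two_mul_card_mates hi
  have hdeg : (∑ _ ∈ mates N i, 1) * 2 + (1 * 2 + (N - 1 - 2 * (mates N i).card)) = N + 1 := by
    rw [Finset.sum_const, smul_eq_mul]
    omega
  exact hdeg ▸ h

theorem separator_mem_multCond_single_two {N i : ℕ} (hi : i < N) :
    separator N i ∈ multCond (N - 1) (Pi.single 2 1) := by
  have h1 := pow_mem_multCond (prod_mem_multCond (p := Pi.single 2 1) (mates N i)
    (f := fun j : ℕ => (X 1 - C (j : ℂ) * X 0)) (a := 1) fun j _ => by simp [mem_multCond_one]) 2
  have h2 := mul_mem_multCond (mem_multCond_zero (p := Pi.single 2 1)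
    ((X 2 - C (((i + 1) % 2 : ℕ) : ℂ) * X 0) ^ 2)) (pow_mem_multCond (f := X 0) (a := 1)
      (by simp [mem_multCond_one]) (N - 1 - 2 * (mates N i).card))
  have := two_mul_card_mates hi
  exact multCond_anti (by omega) _ (mul_mem_multCond h1 h2)

theorem separator_mem_multCond_zigzag {N i j : ℕ} (hj : j < N) (hij : j ≠ i) :
    separator N i ∈ multCond 2 (zigzag j) := by
  by_cases h : j % 2 = i % 2
  · refine mul_mem_multCond_left (pow_mem_multCond (a := 1) ?_ 2) _
    rw [mem_multCond_one, map_prod]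
    refine Finset.prod_eq_zero (i := j) (by simp [mates, *]) ?_
    simp [zigzag]
  · rw [separator, mul_left_comm]
    refine mul_mem_multCond_left ?_ _
    refine pow_mem_multCond (a := 1) ?_ 2
    have hpar : j % 2 = (i + 1) % 2 := by omega
    simp [mem_multCond_one, zigzag, hpar]

theorem aeval_separator_ne_zero (N i : ℕ) : aeval (zigzag i) (separator N i) ≠ 0 := by
  simp only [separator, map_mul, map_pow, map_prod]
  refine mul_ne_zero (pow_ne_zero _ (Finset.prod_ne_zero_iff.2 fun j hj => ?_))
    (mul_ne_zero (pow_ne_zero _ ?_) (pow_ne_zero _ ?_))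
  · have : i ≠ j := fun h => by simp [mates, h] at hj
    simpa [zigzag, sub_eq_zero] using this
  · have : i % 2 ≠ (i + 1) % 2 := by omega
    simpa [zigzag, sub_eq_zero, -Nat.cast_inj] using fun h => this (Nat.cast_injective h)
  · simp [zigzag]

theorem exists_jet_zigzag_eq {N : ℕ} (v : Fin N → Fin 3 → ℂ) :
    ∃ f ∈ homogeneousSubmodule (Fin 3) ℂ (N + 2) ⊓ multCond (N - 2) (Pi.single 2 1),
      ∀ i : Fin N, jet (zigzag i) f = v i := by
  choose L hL hLv using fun i : Fin N =>
    exists_jet_mul_eq (p := zigzag i) rfl (aeval_separator_ne_zero N i) (v i)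
  have hhom : ∀ i : Fin N, (separator N i * L i).IsHomogeneous (N + 2) := fun i =>
    (separator_isHomogeneous i.2).mul (hL i)
  refine ⟨∑ i : Fin N, separator N i * L i, sum_mem fun i _ => ⟨hhom i, ?_⟩, fun j => ?_⟩
  · exact multCond_anti (by omega) _
      (mul_mem_multCond_left (separator_mem_multCond_single_two i.2) _)
  · rw [map_sum, Finset.sum_eq_single j, hLv]
    · intro i _ hij
      rw [← mem_multCond_two_iff_jet (hhom i) rfl]
      exact mul_mem_multCond_left
        (separator_mem_multCond_zigzag j.2 fun h => hij (Fin.ext h.symm)) _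
    · simp

theorem finrank_zigzag (N : ℕ) (hN : 2 ≤ N) :
    Module.finrank ℂ ↥(homogeneousSubmodule (Fin 3) ℂ (N + 2) ⊓
      multCond (N - 2) (Pi.single 2 1) ⊓ ⨅ i : Fin N, multCond 2 (zigzag i)) = 2 * N + 5 := by
  set W := homogeneousSubmodule (Fin 3) ℂ (N + 2) ⊓ multCond (N - 2) (Pi.single 2 1) with hW
  have hfin := finrank_homogeneous_inf_multCond N hN
  rw [← hW] at hfin
  have : Module.Finite ℂ W := Module.finite_of_finrank_pos (by omega)
  let E : MvPolynomial (Fin 3) ℂ →ₗ[ℂ] (Fin N → Fin 3 → ℂ) :=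
    LinearMap.pi fun i => jet (zigzag i)
  have hker : W ⊓ ⨅ i : Fin N, multCond 2 (zigzag i) =
      (LinearMap.ker (E ∘ₗ W.subtype)).map W.subtype := by
    rw [LinearMap.ker_comp, Submodule.map_comap_subtype]
    ext f
    simp only [Submodule.mem_inf (p := W), Submodule.mem_iInf, LinearMap.mem_ker]
    refine and_congr_right fun hf => ?_
    rw [funext_iff]
    exact forall_congr' fun i => mem_multCond_two_iff_jet hf.1 rfl
  have hsurj : Function.Surjective (E ∘ₗ W.subtype) := fun v => by
    obtain ⟨f, hf, hfv⟩ := exists_jet_zigzag_eq v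
    exact ⟨⟨f, hf⟩, funext hfv⟩
  have hrn := LinearMap.finrank_range_add_finrank_ker (E ∘ₗ W.subtype)
  rw [LinearMap.range_eq_top.2 hsurj, finrank_top, hfin] at hrn
  simp only [Module.finrank_pi_fintype, Module.finrank_self, Finset.sum_const, Finset.card_univ,
    Fintype.card_fin, smul_eq_mul] at hrn
  rw [hker, Submodule.finrank_map_subtype_eq]
  omega

theorem exists_matrix_mulVec_single_two {q : Fin 3 → ℂ} (hq : q ≠ 0) :
    ∃ M M' : Matrix (Fin 3) (Fin 3) ℂ, M * M' = 1 ∧ M' * M = 1 ∧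
      M.mulVec (Pi.single 2 1) = q := by
  obtain ⟨A, hA⟩ := SeparatingDual.exists_continuousLinearEquiv_apply_eq (R := ℂ)
    (x := (Pi.single 2 1 : Fin 3 → ℂ)) (by simp) hq
  have h : A.toLinearEquiv.toLinearMap ∘ₗ A.symm.toLinearEquiv.toLinearMap = LinearMap.id := by
    ext1; simp
  have h' : A.symm.toLinearEquiv.toLinearMap ∘ₗ A.toLinearEquiv.toLinearMap = LinearMap.id := by
    ext1; simp
  refine ⟨LinearMap.toMatrix' A.toLinearEquiv.toLinearMap,
    LinearMap.toMatrix' A.symm.toLinearEquiv.toLinearMap, ?_, ?_, ?_⟩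
  · rw [← LinearMap.toMatrix'_comp, h, LinearMap.toMatrix'_id]
  · rw [← LinearMap.toMatrix'_comp, h', LinearMap.toMatrix'_id]
  · rw [LinearMap.toMatrix'_mulVec]
    exact hA

/-- For `n ≥ 3` and `3n - 4 = 2ℓ + ε` with `ε ∈ {0,1}`, and any point `q ∈ ℙ²`, there
exist `ℓ + ε` points, distinct from `q` and pairwise distinct, imposing independent
double-point conditions on the plane curves of degree `3n - 2 - ℓ` with a point of
multiplicity at least `3n - 6 - ℓ` at `q`: the space of such forms with in addition
multiplicity at least `2` at each of the `ℓ + ε` points has dimension exactly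
`3n + ε + 1`. -/
theorem independent_double_points (n ℓ ε : ℕ) (hn : 3 ≤ n)
    (hε : ε = 0 ∨ ε = 1) (hℓ : 3 * n - 4 = 2 * ℓ + ε)
    (q : Fin 3 → ℂ) (hq : q ≠ 0) :
    ∃ q' : Fin (ℓ + ε) → (Fin 3 → ℂ),
      (∀ i, q' i ≠ 0) ∧
      (∀ i, ¬ ∃ c : ℂ, q' i = c • q) ∧
      (∀ i j, i ≠ j → ¬ ∃ c : ℂ, q' i = c • q' j) ∧
      Module.finrank ℂ
        ↥(homogeneousSubmodule (Fin 3) ℂ (3 * n - 2 - ℓ) ⊓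
          multCond (3 * n - 6 - ℓ) q ⊓
          ⨅ i, multCond 2 (q' i)) =
        3 * n + ε + 1 := by
  obtain ⟨M, M', hM, hM', rfl⟩ := exists_matrix_mulVec_single_two hq
  have hinj : ∀ {u w : Fin 3 → ℂ} {c : ℂ}, M.mulVec u = c • M.mulVec w → u = c • w := by
    intro u w c h
    have := congrArg M'.mulVec h
    simpa [Matrix.mulVec_smul, Matrix.mulVec_mulVec, hM'] using this
  refine ⟨fun i => M.mulVec (zigzag i), fun i h => ?_, ?_, ?_, ?_⟩
  · have := congrFun (hinj (c := 0) (w := 0) (h.trans (zero_smul _ _).symm)) 0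
    simp [zigzag] at this
  · rintro i ⟨c, h⟩
    have := congrFun (hinj h) 0
    simp [zigzag] at this
  · rintro i j hij ⟨c, h⟩
    have h0 := congrFun (hinj h) 0
    have h1 := congrFun (hinj h) 1
    simp only [zigzag, Pi.smul_apply, smul_eq_mul, Matrix.cons_val_zero, Matrix.cons_val_one,
      mul_one] at h0 h1
    rw [← h0, one_mul] at h1
    exact hij (Fin.ext (Nat.cast_injective h1))
  · have hcomap : homogeneousSubmodule (Fin 3) ℂ (3 * n - 2 - ℓ) ⊓
        multCond (3 * n - 6 - ℓ) (M.mulVec (Pi.single 2 1)) ⊓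
        ⨅ i : Fin (ℓ + ε), multCond 2 (M.mulVec (zigzag i)) =
        (homogeneousSubmodule (Fin 3) ℂ (ℓ + ε + 2) ⊓ multCond (ℓ + ε - 2) (Pi.single 2 1) ⊓
          ⨅ i : Fin (ℓ + ε), multCond 2 (zigzag i)).comap
            (substEquiv M M' hM hM').toLinearEquiv.toLinearMap := by
      rw [show 3 * n - 2 - ℓ = ℓ + ε + 2 by omega, show 3 * n - 6 - ℓ = ℓ + ε - 2 by omega]
      ext f
      simp [substEquiv_mem_multCond_iff, substEquiv_isHomogeneous_iff]
    rw [hcomap, ((substEquiv M M' hM hM').toLinearEquiv.ofSubmodule' _).finrank_eq,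
      finrank_zigzag _ (by omega)]
    omega
end
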